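/- arXiv:1310.1417 — 4 statements merged into one kernel-verified Lean document; each statement's English description precedes it below -/
import Mathlib

section
/- Let p_1 ≥ 3 be odd, let p_2 be an even positive integer dividing 2p_1, and let p_3 ≥ 2. Then the group Γ(p_1, p_2, p_3), with its generating involutions x_0, x_1, x_2, x_3, satisfies the intersection condition; moreover, in Γ(p_1, p_2, p_3) the element x_0x_1 has order p_1, the element x_2x_3 has order p_3, the order q of x_1x_2 is even and divides p_2, and the order of Γ(p_1, p_2, p_3) equals 2 p_1 q p_3. -/
/-- The intersection condition for a group generated by `n` involutions. -/
def interCond {G : Type*} [Group G] {n : ℕ} (ρ : Fin n → G) : Prop :=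
  ∀ I J : Set (Fin n),
    Subgroup.closure (ρ '' I) ⊓ Subgroup.closure (ρ '' J) = Subgroup.closure (ρ '' (I ∩ J))

/-- The defining relations of the group `Γ(p_1, …, p_{n-1})`: the generators `x_0, …, x_{n-1}`
are involutions, `(x_{i-1} x_i)^{p_i} = 1`, `(x_i x_j)^2 = 1` for `|i - j| ≥ 2`, together with
the extra relators `r_i` (depending on the parities of `p_i` and `p_{i+1}`). -/
def gammaRels (n : ℕ) (p : ℕ → ℕ) : Set (FreeGroup (Fin n)) :=
  {w | (∃ i : Fin n, w = (FreeGroup.of i) ^ 2)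
     ∨ (∃ i j : Fin n, (i : ℕ) + 1 = (j : ℕ) ∧
          w = (FreeGroup.of i * FreeGroup.of j) ^ (p (j : ℕ)))
     ∨ (∃ i j : Fin n, (i : ℕ) + 2 ≤ (j : ℕ) ∧
          w = (FreeGroup.of i * FreeGroup.of j) ^ 2)
     ∨ (∃ a b c : Fin n, (a : ℕ) + 1 = (b : ℕ) ∧ (b : ℕ) + 1 = (c : ℕ) ∧
         ((Even (p (b : ℕ)) ∧ Even (p (c : ℕ)) ∧
             w = (FreeGroup.of a * FreeGroup.of b * FreeGroup.of c * FreeGroup.of b) ^ 2)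
        ∨ (Odd (p (b : ℕ)) ∧ Even (p (c : ℕ)) ∧
             w = (FreeGroup.of a * FreeGroup.of b * FreeGroup.of c * FreeGroup.of b *
                  FreeGroup.of c) ^ 2)
        ∨ (Even (p (b : ℕ)) ∧ Odd (p (c : ℕ)) ∧
             w = (FreeGroup.of c * FreeGroup.of b * FreeGroup.of a * FreeGroup.of b *
                  FreeGroup.of a) ^ 2)))}

/-- The group `Γ(p_1, …, p_{n-1})`. -/
abbrev Gamma (n : ℕ) (p : ℕ → ℕ) : Type := PresentedGroup (gammaRels n p)

/-- The generator `x_i` of `Γ(p_1, …, p_{n-1})`. -/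
def xg (n : ℕ) (p : ℕ → ℕ) (i : Fin n) : Gamma n p := PresentedGroup.of i

/-- The function recording the tuple `(p_1, p_2, p_3)` (indexed so that `pfun3 p1 p2 p3 i = p_i`). -/
def pfun3 (p1 p2 p3 : ℕ) : ℕ → ℕ :=
  fun i => if i = 1 then p1 else if i = 2 then p2 else if i = 3 then p3 else 2

section Involutions

variable {G : Type*} [Group G]

theorem commute_of_mul_sq_eq_one {u v : G} (hu : u ^ 2 = 1) (hv : v ^ 2 = 1)
    (h : (u * v) ^ 2 = 1) : Commute u v := by
  have hu' : u⁻¹ = u := inv_eq_of_mul_eq_one_right (by rwa [← sq])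
  have hv' : v⁻¹ = v := inv_eq_of_mul_eq_one_right (by rwa [← sq])
  have h' : (u * v)⁻¹ = u * v := inv_eq_of_mul_eq_one_right (by rwa [← sq])
  rw [mul_inv_rev, hu', hv'] at h'
  exact h'.symm

theorem conj_eq_inv_of_mul_sq_eq_one {u w : G} (hu : u ^ 2 = 1) (h : (u * w) ^ 2 = 1) :
    u * w * u⁻¹ = w⁻¹ := by
  have hu' : u⁻¹ = u := inv_eq_of_mul_eq_one_right (by rwa [← sq])
  rw [hu']
  apply eq_inv_of_mul_eq_one_left
  rw [← h, sq]
  group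

/-- The homomorphism from a dihedral group sending the two standard reflections to given
involutions. -/
def dihedralHom (n : ℕ) (u v : G) (hu : u ^ 2 = 1) (hv : v ^ 2 = 1) (h : (u * v) ^ n = 1) :
    DihedralGroup n →* G :=
  let φ : ZMod n →+ Additive G := ZMod.lift n
    ⟨zmultiplesHom (Additive G) (Additive.ofMul (u * v)), by
      rw [zmultiplesHom_apply, natCast_zsmul, ← ofMul_pow, h, ofMul_one]⟩
  have hφ : ∀ i, u * (φ i).toMul = (φ (-i)).toMul * u := by
    intro i
    obtain ⟨k, rfl⟩ := ZMod.intCast_surjective i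
    have hu' : u⁻¹ = u := inv_eq_of_mul_eq_one_right (by rwa [← sq])
    have hv' : v⁻¹ = v := inv_eq_of_mul_eq_one_right (by rwa [← sq])
    have hconj : u * (u * v) * u⁻¹ = (u * v)⁻¹ := by
      rw [mul_inv_rev, hu', hv', ← mul_assoc, ← sq, hu, one_mul]
    have hk : u * (u * v) ^ k * u⁻¹ = (u * v) ^ (-k) := by
      rw [← conj_zpow, hconj, inv_zpow, zpow_neg]
    rw [← Int.cast_neg]
    simp only [φ, ZMod.lift_coe, zmultiplesHom_apply, toMul_zsmul, toMul_ofMul]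
    rw [← hk]
    group
  { toFun := fun d => match d with
      | .r i => (φ i).toMul
      | .sr i => u * (φ i).toMul
    map_one' := by
      change (φ 0).toMul = 1
      simp
    map_mul' := by
      rintro (i | i) (j | j)
      · simp
      · simp only [DihedralGroup.r_mul_sr, sub_eq_neg_add, map_add, toMul_add]
        rw [← mul_assoc, ← mul_assoc, hφ, neg_neg]
      · simp [mul_assoc]
      · simp only [DihedralGroup.sr_mul_sr, sub_eq_neg_add, map_add, toMul_add]
        rw [← mul_assoc, hφ, mul_assoc _ u u, ← sq, hu, mul_one] }

@[simp]
theorem dihedralHom_sr_zero (n : ℕ) (u v : G) (hu : u ^ 2 = 1) (hv : v ^ 2 = 1)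
    (h : (u * v) ^ n = 1) : dihedralHom n u v hu hv h (.sr 0) = u := by
  simp [dihedralHom]

@[simp]
theorem dihedralHom_sr_one (n : ℕ) (u v : G) (hu : u ^ 2 = 1) (hv : v ^ 2 = 1)
    (h : (u * v) ^ n = 1) : dihedralHom n u v hu hv h (.sr 1) = v := by
  have hlift := ZMod.lift_coe n (⟨zmultiplesHom (Additive G) (Additive.ofMul (u * v)), by
      rw [zmultiplesHom_apply, natCast_zsmul, ← ofMul_pow, h, ofMul_one]⟩ :
        {f : ℤ →+ Additive G // f n = 0}) 1
  rw [Int.cast_one] at hlift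
  change u * Additive.toMul (ZMod.lift n _ 1) = v
  rw [hlift, zmultiplesHom_apply, one_zsmul, toMul_ofMul, ← mul_assoc, ← sq, hu, one_mul]

theorem closure_pair_sr (n : ℕ) :
    Subgroup.closure {(DihedralGroup.sr 0 : DihedralGroup n), .sr 1} = ⊤ := by
  set H := Subgroup.closure {(DihedralGroup.sr 0 : DihedralGroup n), .sr 1}
  have h0 : (DihedralGroup.sr 0 : DihedralGroup n) ∈ H := Subgroup.subset_closure (by simp)
  have h1 : (DihedralGroup.sr 1 : DihedralGroup n) ∈ H := Subgroup.subset_closure (by simp)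
  have hr : ∀ i : ZMod n, (DihedralGroup.r i : DihedralGroup n) ∈ H := by
    intro i
    obtain ⟨k, rfl⟩ := ZMod.intCast_surjective i
    rw [← DihedralGroup.r_one_zpow]
    apply H.zpow_mem
    simpa using H.mul_mem h0 h1
  refine eq_top_iff.2 fun d _ => ?_
  rcases d with i | i
  · exact hr i
  · simpa using H.mul_mem h0 (hr i)

theorem eq_one_or_eq_of_mem_closure_singleton {u w : G} (hu : u ^ 2 = 1)
    (hw : w ∈ Subgroup.closure {u}) : w = 1 ∨ w = u := by
  obtain ⟨k, rfl⟩ := Subgroup.mem_closure_singleton.1 hw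
  obtain ⟨m, rfl | rfl⟩ := k.even_or_odd'
  · left; rw [zpow_mul, zpow_ofNat, hu, one_zpow]
  · right; rw [zpow_add, zpow_mul, zpow_ofNat, hu, one_zpow, one_mul, zpow_one]

theorem mem_closure_inter_of_subset_pair {ι : Type*} {ρ : ι → G} {i j : ι}
    (hi : ρ i ^ 2 = 1) (hj : ρ j ^ 2 = 1) (hij : ρ i ≠ ρ j) {I J : Set ι}
    (hI : I ⊆ {i, j}) (hJ : J ⊆ {i, j}) {w : G} (hwI : w ∈ Subgroup.closure (ρ '' I))
    (hwJ : w ∈ Subgroup.closure (ρ '' J)) : w ∈ Subgroup.closure (ρ '' (I ∩ J)) := by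
  have key : ∀ {S T : Set ι}, S ⊆ {i} → T ⊆ {j} → w ∈ Subgroup.closure (ρ '' S) →
      w ∈ Subgroup.closure (ρ '' T) → w = 1 := by
    intro S T hS hT hwS hwT
    have h₁ : w ∈ Subgroup.closure {ρ i} := by
      simpa using Subgroup.closure_mono (Set.image_mono hS) hwS
    have h₂ : w ∈ Subgroup.closure {ρ j} := by
      simpa using Subgroup.closure_mono (Set.image_mono hT) hwT
    rcases eq_one_or_eq_of_mem_closure_singleton hi h₁ with h | h
    · exact h
    rcases eq_one_or_eq_of_mem_closure_singleton hj h₂ with h' | h'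
    · exact h'
    exact absurd (h.symm.trans h') hij
  by_cases hIJ : I ⊆ J
  · rwa [Set.inter_eq_left.2 hIJ]
  by_cases hJI : J ⊆ I
  · rwa [Set.inter_eq_right.2 hJI]
  obtain ⟨a, haI, haJ⟩ := Set.not_subset.1 hIJ
  obtain ⟨b, hbJ, hbI⟩ := Set.not_subset.1 hJI
  have hw : w = 1 := by
    rcases hI haI with rfl | rfl <;> rcases hJ hbJ with rfl | rfl
    · exact absurd haI hbI
    · refine key (fun c hc => ?_) (fun c hc => ?_) hwI hwJ
      · rcases hI hc with rfl | rfl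
        · rfl
        · exact absurd hc hbI
      · rcases hJ hc with rfl | rfl
        · exact absurd hc haJ
        · rfl
    · refine key (fun c hc => ?_) (fun c hc => ?_) hwJ hwI
      · rcases hJ hc with rfl | rfl
        · rfl
        · exact absurd hc haJ
      · rcases hI hc with rfl | rfl
        · exact absurd hc hbI
        · rfl
    · exact absurd haI hbI
  rw [hw]
  exact one_mem _

theorem commute_of_mem_closure {S T : Set G} (h : ∀ s ∈ S, ∀ t ∈ T, Commute s t) {a b : G}
    (ha : a ∈ Subgroup.closure S) (hb : b ∈ Subgroup.closure T) : Commute a b := by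
  have hST : Subgroup.closure S ≤ Subgroup.centralizer (Subgroup.closure T) := by
    rw [Subgroup.centralizer_closure, Subgroup.closure_le]
    intro s hs
    exact Subgroup.mem_centralizer_iff.2 fun t ht => ((h s hs t ht).eq).symm
  exact (Subgroup.mem_centralizer_iff.1 (hST ha) b hb).symm

theorem eq_mul_of_mem_closure {H : Type*} [Group H] {S : Set G} {h f g : G →* H}
    (hfg : ∀ s ∈ S, h s = f s * g s) (hcomm : ∀ s ∈ S, ∀ t ∈ S, Commute (f s) (g t)) {w : G}
    (hw : w ∈ Subgroup.closure S) : h w = f w * g w := by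
  have hc : ∀ a ∈ Subgroup.closure S, ∀ b ∈ Subgroup.closure S, Commute (f a) (g b) := by
    intro a ha b hb
    refine commute_of_mem_closure (S := f '' S) (T := g '' S) ?_ ?_ ?_
    · rintro _ ⟨s, hs, rfl⟩ _ ⟨t, ht, rfl⟩
      exact hcomm s hs t ht
    · rw [← MonoidHom.map_closure]; exact ⟨a, ha, rfl⟩
    · rw [← MonoidHom.map_closure]; exact ⟨b, hb, rfl⟩
  induction hw using Subgroup.closure_induction with
  | mem s hs => exact hfg s hs
  | one => simp
  | mul a b ha hb iha ihb =>
    rw [map_mul, iha, ihb]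
    calc f a * g a * (f b * g b) = f a * (g a * f b) * g b := by group
      _ = f a * (f b * g a) * g b := by rw [(hc b hb a ha).eq]
      _ = f (a * b) * g (a * b) := by rw [map_mul, map_mul]; group
  | inv a ha iha =>
    rw [map_inv, map_inv, map_inv, (hc a ha a ha).inv_inv.eq, ← mul_inv_rev, ← iha]

theorem zpowers_normal_of_conj {S : Set G} (hS : Subgroup.closure S = ⊤) {z : G}
    (h : ∀ s ∈ S, s * z * s⁻¹ = z ∨ s * z * s⁻¹ = z⁻¹) : (Subgroup.zpowers z).Normal := by
  have hconj : ∀ w : G, w * z * w⁻¹ = z ∨ w * z * w⁻¹ = z⁻¹ := by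
    intro w
    have hw : w ∈ Subgroup.closure S := hS ▸ Subgroup.mem_top w
    induction hw using Subgroup.closure_induction with
    | mem s hs => exact h s hs
    | one => simp
    | mul a b _ _ iha ihb =>
      have hab : a * b * z * (a * b)⁻¹ = a * (b * z * b⁻¹) * a⁻¹ := by group
      rw [hab]
      rcases ihb with hb | hb <;> rw [hb]
      · exact iha
      · rw [← conj_inv]
        rcases iha with ha | ha <;> simp [ha]
    | inv a _ iha =>
      rcases iha with ha | ha
      · left
        nth_rw 1 [← ha]
        group
      · right
        have ha' : z = a * z⁻¹ * a⁻¹ := by rw [← conj_inv, ha, inv_inv]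
        nth_rw 1 [ha']
        group
  refine ⟨fun n hn w => ?_⟩
  obtain ⟨k, rfl⟩ := Subgroup.mem_zpowers_iff.1 hn
  rw [← conj_zpow]
  refine Subgroup.zpow_mem _ ?_ k
  rcases hconj w with hw | hw <;> simp [hw]

end Involutions

section FourGenerators

variable {G : Type*} [Group G] {x : Fin 4 → G} {f g : G →* G}

theorem exists_eq_mul_zpow_mul (hgen : Subgroup.closure (Set.range x) = ⊤)
    (hx : ∀ i, x i ^ 2 = 1) (h02 : Commute (x 0) (x 2)) (h03 : Commute (x 0) (x 3))
    (h13 : Commute (x 1) (x 3)) (hf : ∀ i, f (x i) = ![x 0, x 1, 1, 1] i)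
    (hg : ∀ i, g (x i) = ![1, 1, x 2, x 3] i)
    (hz : (Subgroup.zpowers ((x 1 * x 2) ^ 2)).Normal) (w : G) :
    ∃ k : ℤ, w = f w * ((x 1 * x 2) ^ 2) ^ k * g w := by
  let π := QuotientGroup.mk' (Subgroup.zpowers ((x 1 * x 2) ^ 2))
  have h12 : Commute (π (x 1)) (π (x 2)) := by
    refine commute_of_mul_sq_eq_one ?_ ?_ ?_
    · rw [← map_pow, hx, map_one]
    · rw [← map_pow, hx, map_one]
    · rw [← map_mul, ← map_pow]
      exact (QuotientGroup.eq_one_iff _).2 (Subgroup.mem_zpowers _)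
  have hπ : π w = (π.comp f) w * (π.comp g) w := by
    refine eq_mul_of_mem_closure (S := Set.range x) ?_ ?_ (hgen ▸ Subgroup.mem_top w)
    · rintro _ ⟨i, rfl⟩
      fin_cases i <;> simp [hf, hg]
    · rintro _ ⟨i, rfl⟩ _ ⟨j, rfl⟩
      fin_cases i <;> fin_cases j <;>
        simp [hf, hg, h12, h02.map π, h03.map π, h13.map π]
  have hmem : (f w)⁻¹ * w * (g w)⁻¹ ∈ Subgroup.zpowers ((x 1 * x 2) ^ 2) := by
    rw [← QuotientGroup.eq_one_iff]
    change π _ = 1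
    rw [map_mul, map_mul, map_inv, map_inv, hπ]
    simp
  obtain ⟨k, hk⟩ := Subgroup.mem_zpowers_iff.1 hmem
  exact ⟨k, by rw [hk]; group⟩

theorem interCond_of_retractions (hx : ∀ i, x i ^ 2 = 1) (h02 : Commute (x 0) (x 2))
    (h03 : Commute (x 0) (x 3)) (h13 : Commute (x 1) (x 3))
    (hf : ∀ i, f (x i) = ![x 0, x 1, 1, 1] i) (hg : ∀ i, g (x i) = ![1, 1, x 2, x 3] i)
    (h01 : x 0 ≠ x 1) (h23 : x 2 ≠ x 3)
    (hz : ∀ w, ∃ k : ℤ, w = f w * ((x 1 * x 2) ^ 2) ^ k * g w) : interCond x := by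
  have hfK : ∀ (K : Set (Fin 4)) (w : G), w ∈ Subgroup.closure (x '' K) →
      f w ∈ Subgroup.closure (x '' (K ∩ {0, 1})) := by
    intro K w hw
    suffices Subgroup.closure (x '' K) ≤ (Subgroup.closure (x '' (K ∩ {0, 1}))).comap f from
      this hw
    rw [Subgroup.closure_le]
    rintro _ ⟨i, hi, rfl⟩
    have hmem : i ∈ ({0, 1} : Set (Fin 4)) → x i ∈ Subgroup.closure (x '' (K ∩ {0, 1})) :=
      fun h => Subgroup.subset_closure ⟨i, ⟨hi, h⟩, rfl⟩
    fin_cases i <;> simp [hf] <;> simpa using hmem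
  have hgK : ∀ (K : Set (Fin 4)) (w : G), w ∈ Subgroup.closure (x '' K) →
      g w ∈ Subgroup.closure (x '' (K ∩ {2, 3})) := by
    intro K w hw
    suffices Subgroup.closure (x '' K) ≤ (Subgroup.closure (x '' (K ∩ {2, 3}))).comap g from
      this hw
    rw [Subgroup.closure_le]
    rintro _ ⟨i, hi, rfl⟩
    have hmem : i ∈ ({2, 3} : Set (Fin 4)) → x i ∈ Subgroup.closure (x '' (K ∩ {2, 3})) :=
      fun h => Subgroup.subset_closure ⟨i, ⟨hi, h⟩, rfl⟩
    fin_cases i <;> simp [hg] <;> simpa using hmem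
  have hsplit : ∀ (K : Set (Fin 4)) (w : G), ¬ (1 ∈ K ∧ 2 ∈ K) →
      w ∈ Subgroup.closure (x '' K) → w = f w * g w := by
    intro K w hK hw
    refine eq_mul_of_mem_closure (h := MonoidHom.id G) ?_ ?_ hw
    · rintro _ ⟨i, -, rfl⟩
      fin_cases i <;> simp [hf, hg]
    · rintro _ ⟨i, hi, rfl⟩ _ ⟨j, hj, rfl⟩
      fin_cases i <;> fin_cases j <;> simp [hf, hg, h02, h03, h13]
      exact absurd ⟨hi, hj⟩ hK
  intro I J
  refine le_antisymm ?_ (le_inf (Subgroup.closure_mono (Set.image_mono Set.inter_subset_left))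
    (Subgroup.closure_mono (Set.image_mono Set.inter_subset_right)))
  rintro w ⟨hwI, hwJ⟩
  have hfw : f w ∈ Subgroup.closure (x '' (I ∩ J)) :=
    Subgroup.closure_mono
      (Set.image_mono (Set.inter_subset_inter Set.inter_subset_left Set.inter_subset_left))
      (mem_closure_inter_of_subset_pair (hx 0) (hx 1) h01 Set.inter_subset_right
        Set.inter_subset_right (hfK I w hwI) (hfK J w hwJ))
  have hgw : g w ∈ Subgroup.closure (x '' (I ∩ J)) :=
    Subgroup.closure_mono
      (Set.image_mono (Set.inter_subset_inter Set.inter_subset_left Set.inter_subset_left))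
      (mem_closure_inter_of_subset_pair (hx 2) (hx 3) h23 Set.inter_subset_right
        Set.inter_subset_right (hgK I w hwI) (hgK J w hwJ))
  by_cases hI : 1 ∈ I ∧ 2 ∈ I
  · by_cases hJ : 1 ∈ J ∧ 2 ∈ J
    · obtain ⟨k, hk⟩ := hz w
      rw [hk]
      have hx1 : x 1 ∈ Subgroup.closure (x '' (I ∩ J)) :=
        Subgroup.subset_closure ⟨1, ⟨hI.1, hJ.1⟩, rfl⟩
      have hx2 : x 2 ∈ Subgroup.closure (x '' (I ∩ J)) :=
        Subgroup.subset_closure ⟨2, ⟨hI.2, hJ.2⟩, rfl⟩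
      exact mul_mem (mul_mem hfw (zpow_mem (pow_mem (mul_mem hx1 hx2) 2) k)) hgw
    · rw [hsplit J w hJ hwJ]
      exact mul_mem hfw hgw
  · rw [hsplit I w hI hwI]
    exact mul_mem hfw hgw

end FourGenerators

section GammaFour

variable {p1 p2 p3 : ℕ}

theorem lift_gammaRels_eq_one {H : Type*} [Group H] (h1odd : Odd p1) (h2even : Even p2)
    {y : Fin 4 → H} (hy : ∀ i, y i ^ 2 = 1) (h01 : (y 0 * y 1) ^ p1 = 1)
    (h12 : (y 1 * y 2) ^ p2 = 1) (h23 : (y 2 * y 3) ^ p3 = 1) (h02 : (y 0 * y 2) ^ 2 = 1)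
    (h03 : (y 0 * y 3) ^ 2 = 1) (h13 : (y 1 * y 3) ^ 2 = 1)
    (hr1 : (y 0 * y 1 * y 2 * y 1 * y 2) ^ 2 = 1)
    (hr2even : (y 1 * y 2 * y 3 * y 2) ^ 2 = 1)
    (hr2odd : (y 3 * y 2 * y 1 * y 2 * y 1) ^ 2 = 1) :
    ∀ r ∈ gammaRels 4 (pfun3 p1 p2 p3), FreeGroup.lift y r = 1 := by
  have h1 : ¬ Even p1 := Nat.not_even_iff_odd.2 h1odd
  have h2 : ¬ Odd p2 := Nat.not_odd_iff_even.2 h2even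
  rintro r (⟨i, rfl⟩ | ⟨i, j, hij, rfl⟩ | ⟨i, j, hij, rfl⟩ | ⟨a, b, c, hab, hbc, h⟩)
  · simpa using hy i
  · fin_cases i <;> fin_cases j <;> simp at hij <;> simp [pfun3, h01, h12, h23]
  · fin_cases i <;> fin_cases j <;> simp at hij <;> simp [h02, h03, h13]
  · fin_cases a <;> fin_cases b <;> simp at hab <;> fin_cases c <;> simp at hbc <;>
      rcases h with ⟨ha, hb, rfl⟩ | ⟨ha, hb, rfl⟩ | ⟨ha, hb, rfl⟩ <;>
      simp [pfun3] at ha hb ⊢ <;>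
      first
      | assumption
      | exact absurd ha h1
      | exact absurd ha h2

theorem lift_xg_eq_one {n : ℕ} {p : ℕ → ℕ} {w : FreeGroup (Fin n)}
    (hw : w ∈ gammaRels n p) : FreeGroup.lift (xg n p) w = 1 := by
  have hlift : FreeGroup.lift (xg n p) = PresentedGroup.mk (gammaRels n p) := by
    ext i; simp [xg, PresentedGroup.of]
  rw [hlift]
  exact PresentedGroup.one_of_mem hw

theorem xg_sq {n : ℕ} {p : ℕ → ℕ} (i : Fin n) : xg n p i ^ 2 = 1 := by
  simpa using lift_xg_eq_one (p := p) (Or.inl ⟨i, rfl⟩)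

theorem xg_mul_pow {n : ℕ} {p : ℕ → ℕ} {i j : Fin n} (hij : (i : ℕ) + 1 = j) :
    (xg n p i * xg n p j) ^ p j = 1 := by
  simpa using lift_xg_eq_one (p := p) (Or.inr (Or.inl ⟨i, j, hij, rfl⟩))

theorem xg_commute {n : ℕ} {p : ℕ → ℕ} {i j : Fin n} (hij : (i : ℕ) + 2 ≤ j) :
    Commute (xg n p i) (xg n p j) := by
  refine commute_of_mul_sq_eq_one (xg_sq i) (xg_sq j) ?_
  simpa using lift_xg_eq_one (p := p) (Or.inr (Or.inr (Or.inl ⟨i, j, hij, rfl⟩)))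

theorem xg_rel_even_even {n : ℕ} {p : ℕ → ℕ} {a b c : Fin n} (hab : (a : ℕ) + 1 = b)
    (hbc : (b : ℕ) + 1 = c) (hb : Even (p b)) (hc : Even (p c)) :
    (xg n p a * xg n p b * xg n p c * xg n p b) ^ 2 = 1 := by
  simpa using lift_xg_eq_one (p := p) (Or.inr (Or.inr (Or.inr
    ⟨a, b, c, hab, hbc, Or.inl ⟨hb, hc, rfl⟩⟩)))

theorem xg_rel_odd_even {n : ℕ} {p : ℕ → ℕ} {a b c : Fin n} (hab : (a : ℕ) + 1 = b)
    (hbc : (b : ℕ) + 1 = c) (hb : Odd (p b)) (hc : Even (p c)) :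
    (xg n p a * xg n p b * xg n p c * xg n p b * xg n p c) ^ 2 = 1 := by
  simpa using lift_xg_eq_one (p := p) (Or.inr (Or.inr (Or.inr
    ⟨a, b, c, hab, hbc, Or.inr (Or.inl ⟨hb, hc, rfl⟩)⟩)))

theorem xg_rel_even_odd {n : ℕ} {p : ℕ → ℕ} {a b c : Fin n} (hab : (a : ℕ) + 1 = b)
    (hbc : (b : ℕ) + 1 = c) (hb : Even (p b)) (hc : Odd (p c)) :
    (xg n p c * xg n p b * xg n p a * xg n p b * xg n p a) ^ 2 = 1 := by
  simpa using lift_xg_eq_one (p := p) (Or.inr (Or.inr (Or.inr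
    ⟨a, b, c, hab, hbc, Or.inr (Or.inr ⟨hb, hc, rfl⟩)⟩)))

theorem closure_range_xg (n : ℕ) (p : ℕ → ℕ) : Subgroup.closure (Set.range (xg n p)) = ⊤ :=
  PresentedGroup.closure_range_of _

theorem zpowers_xg_one_mul_xg_two_sq_normal (h1odd : Odd p1) (h2even : Even p2) :
    (Subgroup.zpowers
      ((xg 4 (pfun3 p1 p2 p3) 1 * xg 4 (pfun3 p1 p2 p3) 2) ^ 2)).Normal := by
  set P := pfun3 p1 p2 p3
  set x := xg 4 P
  have hinv : ∀ i, (x i)⁻¹ = x i := fun i =>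
    inv_eq_of_mul_eq_one_right (by rw [← sq]; exact xg_sq i)
  have hmul : ∀ i, x i * x i = 1 := fun i => by rw [← sq]; exact xg_sq i
  have hmul' : ∀ i (a : Gamma 4 P), x i * (x i * a) = a := fun i a => by
    rw [← mul_assoc, hmul, one_mul]
  refine zpowers_normal_of_conj (closure_range_xg 4 P) ?_
  rintro _ ⟨i, rfl⟩
  fin_cases i
  · right
    have hr : (x 0 * x 1 * x 2 * x 1 * x 2) ^ 2 = 1 :=
      xg_rel_odd_even rfl rfl (by simpa [P, pfun3]) (by simpa [P, pfun3])
    refine conj_eq_inv_of_mul_sq_eq_one (xg_sq 0) ?_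
    change (x 0 * (x 1 * x 2) ^ 2) ^ 2 = 1
    simpa only [sq, mul_assoc] using hr
  · right
    change x 1 * (x 1 * x 2) ^ 2 * (x 1)⁻¹ = _
    simp only [sq, mul_inv_rev, hinv, mul_assoc, hmul']
  · right
    change x 2 * (x 1 * x 2) ^ 2 * (x 2)⁻¹ = _
    simp only [sq, mul_inv_rev, hinv, mul_assoc, hmul, mul_one]
  · change x 3 * (x 1 * x 2) ^ 2 * (x 3)⁻¹ = _ ∨ x 3 * (x 1 * x 2) ^ 2 * (x 3)⁻¹ = _
    rcases Nat.even_or_odd p3 with h3 | h3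
    · left
      have hr : (x 1 * (x 2 * x 3 * x 2)) ^ 2 = 1 := by
        have hr' : (x 1 * x 2 * x 3 * x 2) ^ 2 = 1 :=
          xg_rel_even_even rfl rfl (by simpa [P, pfun3]) (by simpa [P, pfun3])
        simpa only [mul_assoc] using hr'
      have hc : Commute (x 1) (x 2 * x 3 * x 2) :=
        commute_of_mul_sq_eq_one (xg_sq 1) (by simp only [sq, mul_assoc, hmul, hmul']) hr
      have h13 : Commute (x 3) (x 1) := (xg_commute (by decide)).symm
      have h23 : Commute (x 3) (x 2 * x 1 * x 2) := by
        have hconj := congrArg (fun w => x 2 * w * x 2) hc.eq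
        simp only [mul_assoc, hmul, hmul', mul_one] at hconj
        rw [commute_iff_eq]
        simpa only [mul_assoc] using hconj.symm
      have hz : (x 1 * x 2) ^ 2 = x 1 * (x 2 * x 1 * x 2) := by simp only [sq, mul_assoc]
      rw [hz, (h13.mul_right h23).eq, mul_inv_cancel_right]
    · right
      have hr : (x 3 * ((x 1 * x 2) ^ 2)⁻¹) ^ 2 = 1 := by
        have hr' : (x 3 * x 2 * x 1 * x 2 * x 1) ^ 2 = 1 :=
          xg_rel_even_odd rfl rfl (by simpa [P, pfun3]) (by simpa [P, pfun3])
        simpa only [sq, mul_assoc, mul_inv_rev, hinv] using hr'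
      have hconj := conj_eq_inv_of_mul_sq_eq_one (xg_sq 3) hr
      rw [← conj_inv, inv_inj] at hconj
      exact hconj

/-- The projection of `Γ(p_1, p_2, p_3)` onto the dihedral group generated by `x_0` and `x_1`. -/
def leftHom (p3 : ℕ) (h1odd : Odd p1) (h2even : Even p2) :
    Gamma 4 (pfun3 p1 p2 p3) →* DihedralGroup p1 :=
  PresentedGroup.toGroup (f := ![.sr 0, .sr 1, 1, 1])
    (lift_gammaRels_eq_one h1odd h2even
      (by intro i; fin_cases i <;> simp [sq])
      (by simp) (by obtain ⟨k, rfl⟩ := h2even; simp [← two_mul, pow_mul, sq])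
      (by simp) (by simp [sq]) (by simp [sq]) (by simp [sq]) (by simp [sq])
      (by simp [sq]) (by simp))

/-- The projection of `Γ(p_1, p_2, p_3)` onto the dihedral group generated by `x_2` and `x_3`. -/
def rightHom (p3 : ℕ) (h1odd : Odd p1) (h2even : Even p2) :
    Gamma 4 (pfun3 p1 p2 p3) →* DihedralGroup p3 :=
  PresentedGroup.toGroup (f := ![1, 1, .sr 0, .sr 1])
    (lift_gammaRels_eq_one h1odd h2even
      (by intro i; fin_cases i <;> simp [sq])
      (by simp) (by obtain ⟨k, rfl⟩ := h2even; simp [← two_mul, pow_mul, sq])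
      (by simp) (by simp [sq]) (by simp [sq]) (by simp [sq]) (by simp)
      (by simp [sq]) (by simp [sq]))

@[simp]
theorem leftHom_xg (h1odd : Odd p1) (h2even : Even p2) (i : Fin 4) :
    leftHom p3 h1odd h2even (xg 4 _ i) = ![.sr 0, .sr 1, 1, 1] i :=
  PresentedGroup.toGroup.of _

@[simp]
theorem rightHom_xg (h1odd : Odd p1) (h2even : Even p2) (i : Fin 4) :
    rightHom p3 h1odd h2even (xg 4 _ i) = ![1, 1, .sr 0, .sr 1] i :=
  PresentedGroup.toGroup.of _

theorem leftHom_prod_rightHom_surjective (h1odd : Odd p1) (h2even : Even p2) :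
    Function.Surjective ((leftHom p3 h1odd h2even).prod (rightHom p3 h1odd h2even)) := by
  set Φ := (leftHom p3 h1odd h2even).prod (rightHom p3 h1odd h2even)
  rw [← MonoidHom.range_eq_top]
  have hl : (⊤ : Subgroup (DihedralGroup p1)) ≤ Φ.range.comap (MonoidHom.inl _ _) := by
    rw [← closure_pair_sr, Subgroup.closure_le]
    rintro _ (rfl | rfl)
    · exact ⟨xg 4 _ 0, by simp [Φ]⟩
    · exact ⟨xg 4 _ 1, by simp [Φ]⟩
  have hr : (⊤ : Subgroup (DihedralGroup p3)) ≤ Φ.range.comap (MonoidHom.inr _ _) := by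
    rw [← closure_pair_sr, Subgroup.closure_le]
    rintro _ (rfl | rfl)
    · exact ⟨xg 4 _ 2, by simp [Φ]⟩
    · exact ⟨xg 4 _ 3, by simp [Φ]⟩
  refine eq_top_iff.2 fun d _ => ?_
  have hd : d = MonoidHom.inl _ _ d.1 * MonoidHom.inr _ _ d.2 := by simp
  rw [hd]
  exact mul_mem (hl (Subgroup.mem_top _)) (hr (Subgroup.mem_top _))

end GammaFour

/-- If `p_1` is odd, `p_2` is an even positive divisor of `2 p_1`, and `p_3 ≥ 2`, then
`Γ(p_1, p_2, p_3)` satisfies the intersection condition, `x_0 x_1` has order `p_1`,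
`x_2 x_3` has order `p_3`, the order `q` of `x_1 x_2` is even and divides `p_2`, and
`|Γ(p_1, p_2, p_3)| = 2 p_1 q p_3`. -/
theorem gamma_odd_even_any (p1 p2 p3 : ℕ) (h1 : 3 ≤ p1) (h1odd : Odd p1)
    (h2pos : 0 < p2) (h2even : Even p2) (h2dvd : p2 ∣ 2 * p1) (h3 : 2 ≤ p3) :
    let P := pfun3 p1 p2 p3
    interCond (xg 4 P) ∧
    orderOf (xg 4 P 0 * xg 4 P 1) = p1 ∧
    orderOf (xg 4 P 2 * xg 4 P 3) = p3 ∧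
    Even (orderOf (xg 4 P 1 * xg 4 P 2)) ∧
    orderOf (xg 4 P 1 * xg 4 P 2) ∣ p2 ∧
    Nat.card (Gamma 4 P) = 2 * p1 * orderOf (xg 4 P 1 * xg 4 P 2) * p3 := by
  intro P
  have hp1 : (xg 4 P 0 * xg 4 P 1) ^ p1 = 1 := xg_mul_pow (p := P) rfl
  have hp2 : (xg 4 P 1 * xg 4 P 2) ^ p2 = 1 := xg_mul_pow (p := P) rfl
  have hp3 : (xg 4 P 2 * xg 4 P 3) ^ p3 = 1 := xg_mul_pow (p := P) rfl
  let L := leftHom p3 h1odd h2even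
  let R := rightHom p3 h1odd h2even
  let σ := dihedralHom p1 (xg 4 P 0) (xg 4 P 1) (xg_sq 0) (xg_sq 1) hp1
  let τ := dihedralHom p3 (xg 4 P 2) (xg 4 P 3) (xg_sq 2) (xg_sq 3) hp3
  let f := σ.comp L
  let g := τ.comp R
  have hL : ∀ i, L (xg 4 P i) = ![.sr 0, .sr 1, 1, 1] i := leftHom_xg h1odd h2even
  have hR : ∀ i, R (xg 4 P i) = ![1, 1, .sr 0, .sr 1] i := rightHom_xg h1odd h2even
  have hf : ∀ i, f (xg 4 P i) = ![xg 4 P 0, xg 4 P 1, 1, 1] i := by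
    intro i
    fin_cases i <;> simp [f, σ, hL]
  have hg : ∀ i, g (xg 4 P i) = ![1, 1, xg 4 P 2, xg 4 P 3] i := by
    intro i
    fin_cases i <;> simp [g, τ, hR]
  have hz : ∀ w, ∃ k : ℤ, w = f w * ((xg 4 P 1 * xg 4 P 2) ^ 2) ^ k * g w :=
    exists_eq_mul_zpow_mul (closure_range_xg 4 P) xg_sq (xg_commute (by decide))
      (xg_commute (by decide)) (xg_commute (by decide)) hf hg
      (zpowers_xg_one_mul_xg_two_sq_normal h1odd h2even)
  have ho1 : orderOf (xg 4 P 0 * xg 4 P 1) = p1 := by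
    refine Nat.dvd_antisymm (orderOf_dvd_of_pow_eq_one hp1) ?_
    have h := orderOf_map_dvd L (xg 4 P 0 * xg 4 P 1)
    simpa [hL] using h
  have ho3 : orderOf (xg 4 P 2 * xg 4 P 3) = p3 := by
    refine Nat.dvd_antisymm (orderOf_dvd_of_pow_eq_one hp3) ?_
    have h := orderOf_map_dvd R (xg 4 P 2 * xg 4 P 3)
    simpa [hR] using h
  have hev : 2 ∣ orderOf (xg 4 P 1 * xg 4 P 2) := by
    have h := orderOf_map_dvd L (xg 4 P 1 * xg 4 P 2)
    simpa [hL] using h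
  have hker : (L.prod R).ker = Subgroup.zpowers ((xg 4 P 1 * xg 4 P 2) ^ 2) := by
    refine le_antisymm (fun w hw => ?_) ?_
    · obtain ⟨hwL, hwR⟩ := Prod.ext_iff.1 (MonoidHom.mem_ker.1 hw)
      obtain ⟨k, hk⟩ := hz w
      have hfw : f w = 1 := (congrArg σ hwL).trans (map_one σ)
      have hgw : g w = 1 := (congrArg τ hwR).trans (map_one τ)
      rw [hfw, hgw, one_mul, mul_one] at hk
      exact Subgroup.mem_zpowers_iff.2 ⟨k, hk.symm⟩
    · rw [Subgroup.zpowers_le, MonoidHom.mem_ker]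
      simp [hL, hR, sq]
  refine ⟨interCond_of_retractions xg_sq (xg_commute (by decide)) (xg_commute (by decide))
    (xg_commute (by decide)) hf hg ?_ ?_ hz, ho1, ho3, even_iff_two_dvd.2 hev,
    orderOf_dvd_of_pow_eq_one hp2, ?_⟩
  · intro h
    rw [h, ← sq, xg_sq, orderOf_one] at ho1
    omega
  · intro h
    rw [h, ← sq, xg_sq, orderOf_one] at ho3
    omega
  · rw [← Subgroup.card_mul_index (L.prod R).ker, Subgroup.index_ker,
      MonoidHom.range_eq_top.2 (leftHom_prod_rightHom_surjective h1odd h2even),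
      Subgroup.card_top, Nat.card_prod, DihedralGroup.nat_card, DihedralGroup.nat_card, hker,
      Nat.card_zpowers, orderOf_pow_of_dvd two_ne_zero hev]
    obtain ⟨m, hm⟩ := hev
    rw [hm, Nat.mul_div_cancel_left m two_pos]
    ring
end

section
/- Let n ≥ 3 and let p_1, …, p_{n−1} be integers, each at least 2, and suppose p_i = 2 for some i with 1 ≤ i ≤ n−1. Then the natural homomorphism from Γ(p_1, …, p_i) (with generators y_0, …, y_i) to Γ(p_1, …, p_{n−1}) sending y_j to x_j for 0 ≤ j ≤ i is injective, with image the subgroup of Γ(p_1, …, p_{n−1}) generated by x_0, …, x_i; dually, the natural homomorphism from Γ(p_i, …, p_{n−1}) to Γ(p_1, …, p_{n−1}) sending its generators in order to x_{i−1}, …, x_{n−1} is injective, with image the subgroup generated by x_{i−1}, …, x_{n−1}. -/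
/-- A family of elements of a group satisfying the defining relations of `Γ(p_1, …, p_{n-1})`. -/
structure IsGammaSystem {G : Type*} [Group G] (n : ℕ) (p : ℕ → ℕ) (f : Fin n → G) : Prop where
  sq : ∀ i, f i ^ 2 = 1
  adj : ∀ i j : Fin n, (i : ℕ) + 1 = j → (f i * f j) ^ p j = 1
  far : ∀ i j : Fin n, (i : ℕ) + 2 ≤ j → (f i * f j) ^ 2 = 1
  even_even : ∀ a b c : Fin n, (a : ℕ) + 1 = b → (b : ℕ) + 1 = c → Even (p b) → Even (p c) →
    (f a * f b * f c * f b) ^ 2 = 1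
  odd_even : ∀ a b c : Fin n, (a : ℕ) + 1 = b → (b : ℕ) + 1 = c → Odd (p b) → Even (p c) →
    (f a * f b * f c * f b * f c) ^ 2 = 1
  even_odd : ∀ a b c : Fin n, (a : ℕ) + 1 = b → (b : ℕ) + 1 = c → Even (p b) → Odd (p c) →
    (f c * f b * f a * f b * f a) ^ 2 = 1

theorem isGammaSystem_iff {G : Type*} [Group G] {n : ℕ} {p : ℕ → ℕ} {f : Fin n → G} :
    IsGammaSystem n p f ↔ ∀ w ∈ gammaRels n p, FreeGroup.lift f w = 1 := by
  constructor
  · rintro h w (⟨i, rfl⟩ | ⟨i, j, hij, rfl⟩ | ⟨i, j, hij, rfl⟩ | ⟨a, b, c, hab, hbc,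
      ⟨h₁, h₂, rfl⟩ | ⟨h₁, h₂, rfl⟩ | ⟨h₁, h₂, rfl⟩⟩) <;>
      simp only [map_pow, map_mul, FreeGroup.lift_apply_of]
    · exact h.sq i
    · exact h.adj i j hij
    · exact h.far i j hij
    · exact h.even_even a b c hab hbc h₁ h₂
    · exact h.odd_even a b c hab hbc h₁ h₂
    · exact h.even_odd a b c hab hbc h₁ h₂
  · intro h
    refine ⟨fun i => ?_, fun i j hij => ?_, fun i j hij => ?_, fun a b c hab hbc h₁ h₂ => ?_,
      fun a b c hab hbc h₁ h₂ => ?_, fun a b c hab hbc h₁ h₂ => ?_⟩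
    · simpa using h _ (.inl ⟨i, rfl⟩)
    · simpa using h _ (.inr (.inl ⟨i, j, hij, rfl⟩))
    · simpa using h _ (.inr (.inr (.inl ⟨i, j, hij, rfl⟩)))
    · simpa using h _ (.inr (.inr (.inr ⟨a, b, c, hab, hbc, .inl ⟨h₁, h₂, rfl⟩⟩)))
    · simpa using h _ (.inr (.inr (.inr ⟨a, b, c, hab, hbc, .inr (.inl ⟨h₁, h₂, rfl⟩)⟩)))
    · simpa using h _ (.inr (.inr (.inr ⟨a, b, c, hab, hbc, .inr (.inr ⟨h₁, h₂, rfl⟩)⟩)))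

theorem isGammaSystem_xg (n : ℕ) (p : ℕ → ℕ) : IsGammaSystem n p (xg n p) := by
  rw [isGammaSystem_iff]
  intro w hw
  have : FreeGroup.lift (xg n p) = PresentedGroup.mk (gammaRels n p) := by
    ext i
    simp [xg, PresentedGroup.of]
  rw [this]
  exact PresentedGroup.one_of_mem hw

theorem IsGammaSystem.exists_hom {G : Type*} [Group G] {n : ℕ} {p : ℕ → ℕ} {f : Fin n → G}
    (h : IsGammaSystem n p f) : ∃ φ : Gamma n p →* G, ∀ i, φ (xg n p i) = f i :=
  ⟨PresentedGroup.toGroup (isGammaSystem_iff.1 h), fun _ => PresentedGroup.toGroup.of _⟩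

/-- A map of generators `Γ(q) → Γ(p)` that respects the relations, together with a family in
`Γ(q)` retracting it, induces an injective homomorphism. -/
theorem IsGammaSystem.exists_injective_hom {n m : ℕ} {p q : ℕ → ℕ} {e : Fin m → Fin n}
    (he : IsGammaSystem m q (fun j => xg n p (e j))) {f : Fin n → Gamma m q}
    (hf : IsGammaSystem n p f) (hfe : ∀ j, f (e j) = xg m q j) :
    ∃ φ : Gamma m q →* Gamma n p, Function.Injective φ ∧ (∀ j, φ (xg m q j) = xg n p (e j)) ∧
      φ.range = Subgroup.closure (Set.range fun j => xg n p (e j)) := by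
  obtain ⟨φ, hφ⟩ := he.exists_hom
  obtain ⟨ρ, hρ⟩ := hf.exists_hom
  have hid : ρ.comp φ = MonoidHom.id _ :=
    PresentedGroup.ext fun j => by
      change ρ (φ (xg m q j)) = xg m q j
      rw [hφ, hρ, hfe]
  refine ⟨φ, Function.LeftInverse.injective (g := ρ) (DFunLike.congr_fun hid), hφ, ?_⟩
  rw [MonoidHom.range_eq_map, ← PresentedGroup.closure_range_of, MonoidHom.map_closure,
    ← Set.range_comp]
  exact congrArg (fun s => Subgroup.closure (Set.range s)) (funext hφ)

theorem commute_of_sq_eq_one {G : Type*} [Group G] {a b : G} (ha : a ^ 2 = 1) (hb : b ^ 2 = 1)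
    (hab : (a * b) ^ 2 = 1) : Commute a b := by
  have h₁ : a⁻¹ = a := inv_eq_of_mul_eq_one_right (by rwa [← sq])
  have h₂ : b⁻¹ = b := inv_eq_of_mul_eq_one_right (by rwa [← sq])
  have h₃ : (a * b)⁻¹ = a * b := inv_eq_of_mul_eq_one_right (by rwa [← sq])
  rw [mul_inv_rev, h₁, h₂] at h₃
  exact h₃.symm

theorem Commute.mul_sq_eq_one {G : Type*} [Group G] {a b : G} (h : Commute a b)
    (ha : a ^ 2 = 1) (hb : b ^ 2 = 1) : (a * b) ^ 2 = 1 := by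
  rw [h.mul_pow, ha, hb, one_mul]

/-- To check the defining relations it suffices, at each place, to check either those relations or
that the elements involved commute. -/
theorem IsGammaSystem.of_commute {G : Type*} [Group G] {n : ℕ} {p : ℕ → ℕ} {f : Fin n → G}
    (sq : ∀ i, f i ^ 2 = 1)
    (adj : ∀ i j : Fin n, (i : ℕ) + 1 = j →
      (f i * f j) ^ p j = 1 ∨ (Commute (f i) (f j) ∧ (Odd (p j) → f i = f j)))
    (far : ∀ i j : Fin n, (i : ℕ) + 2 ≤ j → Commute (f i) (f j))
    (triple : ∀ a b c : Fin n, (a : ℕ) + 1 = b → (b : ℕ) + 1 = c →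
      ((Even (p b) → Even (p c) → (f a * f b * f c * f b) ^ 2 = 1) ∧
        (Odd (p b) → Even (p c) → (f a * f b * f c * f b * f c) ^ 2 = 1) ∧
        (Even (p b) → Odd (p c) → (f c * f b * f a * f b * f a) ^ 2 = 1)) ∨
      (Commute (f a) (f b) ∧ Commute (f b) (f c))) :
    IsGammaSystem n p f := by
  have key : ∀ a b c : Fin n, (a : ℕ) + 1 = b → (b : ℕ) + 1 = c →
      (Even (p b) → Even (p c) → (f a * f b * f c * f b) ^ 2 = 1) ∧
        (Odd (p b) → Even (p c) → (f a * f b * f c * f b * f c) ^ 2 = 1) ∧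
        (Even (p b) → Odd (p c) → (f c * f b * f a * f b * f a) ^ 2 = 1) := by
    intro a b c hab hbc
    obtain h | ⟨h₁, h₂⟩ := triple a b c hab hbc
    · exact h
    have h₃ : Commute (f a) (f c) := far a c (by omega)
    have e₁ : (f a * f b) ^ 2 = 1 := h₁.mul_sq_eq_one (sq a) (sq b)
    have e₂ : (f a * f b * f c) ^ 2 = 1 := (h₃.mul_left h₂).mul_sq_eq_one e₁ (sq c)
    have e₃ : (f c * f b) ^ 2 = 1 := h₂.symm.mul_sq_eq_one (sq c) (sq b)
    have e₄ : (f c * f b * f a) ^ 2 = 1 := (h₃.symm.mul_left h₁.symm).mul_sq_eq_one e₃ (sq a)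
    have e₅ : (f a * f b * f c * f b) ^ 2 = 1 :=
      ((h₁.mul_left (Commute.refl _)).mul_left h₂.symm).mul_sq_eq_one e₂ (sq b)
    have e₆ : (f c * f b * f a * f b) ^ 2 = 1 :=
      ((h₂.symm.mul_left (Commute.refl _)).mul_left h₁).mul_sq_eq_one e₄ (sq b)
    refine ⟨fun _ _ => e₅, fun _ _ => ?_, fun _ _ => ?_⟩
    · exact (((h₃.mul_left h₂).mul_left (Commute.refl _)).mul_left h₂).mul_sq_eq_one e₅ (sq c)
    · exact (((h₃.symm.mul_left h₁.symm).mul_left (Commute.refl _)).mul_left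
        h₁.symm).mul_sq_eq_one e₆ (sq a)
  refine ⟨sq, fun i j hij => ?_, fun i j hij => (far i j hij).mul_sq_eq_one (sq i) (sq j),
    fun a b c hab hbc => (key a b c hab hbc).1, fun a b c hab hbc => (key a b c hab hbc).2.1,
    fun a b c hab hbc => (key a b c hab hbc).2.2⟩
  obtain h | ⟨h₁, h₂⟩ := adj i j hij
  · exact h
  obtain hev | hodd := Nat.even_or_odd (p j)
  · obtain ⟨k, hk⟩ := hev.two_dvd
    rw [hk, pow_mul, h₁.mul_sq_eq_one (sq i) (sq j), one_pow]
  · rw [h₂ hodd, ← _root_.sq, sq j, one_pow]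

theorem IsGammaSystem.commute_far {G : Type*} [Group G] {n : ℕ} {p : ℕ → ℕ} {f : Fin n → G}
    (h : IsGammaSystem n p f) {i j : Fin n} (hij : (i : ℕ) + 2 ≤ j) : Commute (f i) (f j) :=
  commute_of_sq_eq_one (h.sq i) (h.sq j) (h.far i j hij)

theorem IsGammaSystem.commute_adj {G : Type*} [Group G] {n : ℕ} {p : ℕ → ℕ} {f : Fin n → G}
    (h : IsGammaSystem n p f) {i j : Fin n} (hij : (i : ℕ) + 1 = j) (hp : p j = 2) :
    Commute (f i) (f j) :=
  commute_of_sq_eq_one (h.sq i) (h.sq j) (hp ▸ h.adj i j hij)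

/-- A string of consecutive members of a system for `p` is a system for the corresponding
subtuple. -/
theorem IsGammaSystem.comp {G : Type*} [Group G] {n m d : ℕ} {p q : ℕ → ℕ} {f : Fin n → G}
    (h : IsGammaSystem n p f) {e : Fin m → Fin n} (he : ∀ j, (e j : ℕ) = d + j)
    (hq : ∀ k, q k = p (d + k)) : IsGammaSystem m q (fun j => f (e j)) := by
  have hqe : ∀ j : Fin m, q j = p (e j) := fun j => by rw [hq, he]
  refine ⟨fun i => h.sq _, fun i j hij => ?_, fun i j hij => h.far _ _ ?_,
    fun a b c hab hbc h₁ h₂ => ?_, fun a b c hab hbc h₁ h₂ => ?_, fun a b c hab hbc h₁ h₂ => ?_⟩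
  · rw [hqe]
    exact h.adj _ _ (by rw [he, he]; omega)
  · rw [he, he]; omega
  all_goals rw [hqe] at h₁ h₂
  · exact h.even_even _ _ _ (by rw [he, he]; omega) (by rw [he, he]; omega) h₁ h₂
  · exact h.odd_even _ _ _ (by rw [he, he]; omega) (by rw [he, he]; omega) h₁ h₂
  · exact h.even_odd _ _ _ (by rw [he, he]; omega) (by rw [he, he]; omega) h₁ h₂

open Classical in
/-- A system of length `i + 1` whose last member `z` is central among them extends to longer
systems by members equal to `z` or `1`. -/
theorem IsGammaSystem.exists_extend_right {G : Type*} [Group G] {n i : ℕ} {p : ℕ → ℕ}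
    {g : Fin (i + 1) → G} (hg : IsGammaSystem (i + 1) p g)
    (hz : ∀ j, Commute (g j) (g (Fin.last i))) :
    ∃ f : Fin n → G, IsGammaSystem n p f ∧
      ∀ (j : Fin n) (hj : (j : ℕ) < i + 1), f j = g ⟨j, hj⟩ := by
  set f : Fin n → G := fun j => if hj : (j : ℕ) < i + 1 then g ⟨j, hj⟩ else
    if ∀ k, i < k → k ≤ j → Odd (p k) then g (Fin.last i) else 1
  have hlt : ∀ (j : Fin n) (hj : (j : ℕ) < i + 1), f j = g ⟨j, hj⟩ := fun j hj => dif_pos hj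
  have hge : ∀ j : Fin n, i ≤ (j : ℕ) →
      f j = if ∀ k, i < k → k ≤ (j : ℕ) → Odd (p k) then g (Fin.last i) else 1 := by
    intro j hj
    by_cases h : (j : ℕ) < i + 1
    · rw [hlt j h, if_pos fun k h₁ h₂ => by omega]
      congr 1
      exact Fin.ext (by simp only [Fin.val_last]; omega)
    · exact dif_neg h
  have hmem : ∀ j : Fin n, f j = 1 ∨ ∃ k, f j = g k := by
    intro j
    by_cases h : (j : ℕ) < i + 1
    · exact .inr ⟨_, hlt j h⟩
    · rw [hge j (by omega)]
      split_ifs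
      exacts [.inr ⟨_, rfl⟩, .inl rfl]
  have hcomm : ∀ a b : Fin n, i ≤ (b : ℕ) → Commute (f a) (f b) := by
    intro a b hb
    rw [hge b hb]
    split_ifs
    · obtain h | ⟨k, h⟩ := hmem a <;> rw [h]
      exacts [Commute.one_left _, hz k]
    · exact Commute.one_right _
  refine ⟨f, .of_commute (fun j => ?_) (fun a b hab => ?_) (fun a b hab => ?_)
    (fun a b c hab hbc => ?_), hlt⟩
  · obtain h | ⟨k, h⟩ := hmem j <;> rw [h]
    exacts [one_pow 2, hg.sq k]
  · by_cases hb : (b : ℕ) < i + 1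
    · rw [hlt b hb, hlt a (by omega)]
      exact .inl (hg.adj _ _ hab)
    · refine .inr ⟨hcomm a b (by omega), fun hodd => ?_⟩
      rw [hge b (by omega), hge a (by omega)]
      refine if_congr ⟨fun h k h₁ h₂ => ?_, fun h k h₁ h₂ => h k h₁ (by omega)⟩ rfl rfl
      obtain h₃ | rfl := h₂.lt_or_eq
      exacts [h k h₁ (by omega), hodd]
  · by_cases hb : (b : ℕ) < i + 1
    · rw [hlt b hb, hlt a (by omega)]
      exact hg.commute_far hab
    · exact hcomm a b (by omega)
  · by_cases hc : (c : ℕ) < i + 1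
    · rw [hlt c hc, hlt b (by omega), hlt a (by omega)]
      exact .inl ⟨hg.even_even ⟨a, _⟩ ⟨b, _⟩ ⟨c, hc⟩ hab hbc,
        hg.odd_even ⟨a, _⟩ ⟨b, _⟩ ⟨c, hc⟩ hab hbc,
        hg.even_odd ⟨a, _⟩ ⟨b, _⟩ ⟨c, hc⟩ hab hbc⟩
    · exact .inr ⟨hcomm a b (by omega), hcomm b c (by omega)⟩

open Classical in
/-- A system of length `m + 1` whose first member `z` is central among them extends to the left,
by `d` members equal to `z` or `1`. -/
theorem IsGammaSystem.exists_extend_left {G : Type*} [Group G] {n m d : ℕ} {p : ℕ → ℕ}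
    (hn : n = d + (m + 1)) {g : Fin (m + 1) → G}
    (hg : IsGammaSystem (m + 1) (fun k => p (d + k)) g) (hz : ∀ j, Commute (g j) (g 0)) :
    ∃ f : Fin n → G, IsGammaSystem n p f ∧
      ∀ (j : Fin n) (k : Fin (m + 1)), (j : ℕ) = d + k → f j = g k := by
  set f : Fin n → G := fun j => if hj : d ≤ (j : ℕ) then g ⟨j - d, by omega⟩ else
    if ∀ k, (j : ℕ) < k → k ≤ d → Odd (p k) then g 0 else 1 with hf
  have hge : ∀ (j : Fin n) (k : Fin (m + 1)), (j : ℕ) = d + k → f j = g k := by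
    intro j k hjk
    rw [hf]
    dsimp only
    rw [dif_pos (by omega)]
    congr 1
    exact Fin.ext (by simp only; omega)
  have hle : ∀ j : Fin n, (j : ℕ) ≤ d →
      f j = if ∀ k, (j : ℕ) < k → k ≤ d → Odd (p k) then g 0 else 1 := by
    intro j hj
    by_cases h : d ≤ (j : ℕ)
    · rw [hge j 0 (by simp only [Fin.val_zero]; omega), if_pos fun k h₁ h₂ => by omega]
    · exact dif_neg h
  have hex : ∀ j : Fin n, d ≤ (j : ℕ) → ∃ k : Fin (m + 1), (j : ℕ) = d + k := fun j hj =>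
    ⟨⟨j - d, by omega⟩, by simp only; omega⟩
  have hmem : ∀ j : Fin n, f j = 1 ∨ ∃ k, f j = g k := by
    intro j
    by_cases h : d ≤ (j : ℕ)
    · obtain ⟨k, hk⟩ := hex j h
      exact .inr ⟨k, hge j k hk⟩
    · rw [hle j (by omega)]
      split_ifs
      exacts [.inr ⟨_, rfl⟩, .inl rfl]
  have hcomm : ∀ a b : Fin n, (a : ℕ) ≤ d → Commute (f a) (f b) := by
    intro a b ha
    rw [hle a ha]
    split_ifs
    · obtain h | ⟨k, h⟩ := hmem b <;> rw [h]
      exacts [Commute.one_right _, (hz k).symm]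
    · exact Commute.one_left _
  refine ⟨f, .of_commute (fun j => ?_) (fun a b hab => ?_) (fun a b hab => ?_)
    (fun a b c hab hbc => ?_), hge⟩
  · obtain h | ⟨k, h⟩ := hmem j <;> rw [h]
    exacts [one_pow 2, hg.sq k]
  · by_cases ha : d ≤ (a : ℕ)
    · obtain ⟨k, hk⟩ := hex a ha
      obtain ⟨l, hl⟩ := hex b (by omega)
      rw [hge a k hk, hge b l hl, hl]
      exact .inl (hg.adj k l (by omega))
    · refine .inr ⟨hcomm a b (by omega), fun hodd => ?_⟩
      rw [hle a (by omega), hle b (by omega)]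
      refine if_congr ⟨fun h k h₁ h₂ => h k (by omega) h₂, fun h k h₁ h₂ => ?_⟩ rfl rfl
      obtain h₃ | rfl : (b : ℕ) < k ∨ (b : ℕ) = k := by omega
      exacts [h k h₃ h₂, hodd]
  · by_cases ha : d ≤ (a : ℕ)
    · obtain ⟨k, hk⟩ := hex a ha
      obtain ⟨l, hl⟩ := hex b (by omega)
      rw [hge a k hk, hge b l hl]
      exact hg.commute_far (by omega)
    · exact hcomm a b (by omega)
  · by_cases ha : d ≤ (a : ℕ)
    · obtain ⟨k, hk⟩ := hex a ha
      obtain ⟨l, hl⟩ := hex b (by omega)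
      obtain ⟨r, hr⟩ := hex c (by omega)
      rw [hge a k hk, hge b l hl, hge c r hr, hl, hr]
      exact .inl ⟨hg.even_even _ _ _ (by omega) (by omega),
        hg.odd_even _ _ _ (by omega) (by omega), hg.even_odd _ _ _ (by omega) (by omega)⟩
    · exact .inr ⟨hcomm a b (by omega), hcomm b c (by omega)⟩

/-- Suppose `p_i = 2` for some `1 ≤ i ≤ n-1`. Then the natural homomorphism from
`Γ(p_1, …, p_i)` to `Γ(p_1, …, p_{n-1})` sending `y_j ↦ x_j` is injective with image
`⟨x_0, …, x_i⟩`; dually, the natural homomorphism from `Γ(p_i, …, p_{n-1})` sending its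
generators in order to `x_{i-1}, …, x_{n-1}` is injective with image `⟨x_{i-1}, …, x_{n-1}⟩`. -/
theorem gamma_subgroup_of_two (n : ℕ) (hn : 3 ≤ n) (p : ℕ → ℕ)
    (hp : ∀ k : ℕ, 1 ≤ k → k ≤ n - 1 → 2 ≤ p k)
    (i : ℕ) (hi1 : 1 ≤ i) (hi2 : i ≤ n - 1) (hpi : p i = 2) :
    (∃ φ : Gamma (i + 1) p →* Gamma n p, Function.Injective φ ∧
      (∀ j : Fin (i + 1), φ (xg (i + 1) p j) = xg n p (Fin.castLE (by omega) j)) ∧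
      φ.range = Subgroup.closure {g : Gamma n p | ∃ j : Fin n, (j : ℕ) ≤ i ∧ g = xg n p j}) ∧
    (∃ ψ : Gamma (n - i + 1) (fun k => p (i - 1 + k)) →* Gamma n p, Function.Injective ψ ∧
      (∀ j : Fin (n - i + 1), ψ (xg (n - i + 1) (fun k => p (i - 1 + k)) j) =
        xg n p (Fin.cast (by omega) (Fin.addNat j (i - 1)))) ∧
      ψ.range = Subgroup.closure
        {g : Gamma n p | ∃ j : Fin n, i - 1 ≤ (j : ℕ) ∧ g = xg n p j}) := by
  constructor
  · have hg := isGammaSystem_xg (i + 1) p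
    obtain ⟨f, hf, hfe⟩ := hg.exists_extend_right (n := n) fun j => by
      obtain h | h | h : (j : ℕ) + 2 ≤ i ∨ (j : ℕ) + 1 = i ∨ (j : ℕ) = i := by omega
      · exact hg.commute_far h
      · exact hg.commute_adj h hpi
      · rw [show j = Fin.last i from Fin.ext h]
    obtain ⟨φ, hφ, hφx, hφr⟩ := IsGammaSystem.exists_injective_hom
      (e := Fin.castLE (by omega : i + 1 ≤ n))
      ((isGammaSystem_xg n p).comp (d := 0) (fun j => by simp) (fun k => by simp)) hf
      (fun j => hfe _ j.isLt)
    refine ⟨φ, hφ, hφx, hφr.trans (congrArg _ (Set.ext fun g => ⟨?_, ?_⟩))⟩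
    · rintro ⟨j, rfl⟩
      exact ⟨_, Nat.lt_succ_iff.1 j.isLt, rfl⟩
    · rintro ⟨j, hj, rfl⟩
      exact ⟨⟨j, by omega⟩, rfl⟩
  · have hg := isGammaSystem_xg (n - i + 1) (fun k => p (i - 1 + k))
    obtain ⟨f, hf, hfe⟩ := hg.exists_extend_left (n := n) (by omega) fun j => by
      obtain h | h | h : 0 + 2 ≤ (j : ℕ) ∨ 0 + 1 = (j : ℕ) ∨ j = 0 := by
        rw [Fin.ext_iff, Fin.val_zero]
        omega
      · exact (hg.commute_far (i := 0) h).symm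
      · refine (hg.commute_adj (i := 0) h ?_).symm
        rw [← h, ← hpi]
        congr 1
        omega
      · rw [h]
    obtain ⟨ψ, hψ, hψx, hψr⟩ := IsGammaSystem.exists_injective_hom
      (e := fun j : Fin (n - i + 1) =>
        Fin.cast (by omega : n - i + 1 + (i - 1) = n) (Fin.addNat j (i - 1)))
      ((isGammaSystem_xg n p).comp (d := i - 1) (fun j => by simp [add_comm]) (fun _ => rfl)) hf
      (fun j => hfe _ j (by simp [add_comm]))
    refine ⟨ψ, hψ, hψx, hψr.trans (congrArg _ (Set.ext fun g => ⟨?_, ?_⟩))⟩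
    · rintro ⟨j, rfl⟩
      exact ⟨_, by simp, rfl⟩
    · rintro ⟨j, hj, rfl⟩
      refine ⟨⟨j - (i - 1), by omega⟩, congrArg _ (Fin.ext ?_)⟩
      simp only [Fin.val_cast, Fin.val_addNat]
      omega
end

section
/- Let p_1 ≥ 3 be odd, let p_2 be an even positive integer dividing 2p_1, and let p_3 ≥ 3 be odd with p_2 dividing 2p_3. On the set (ℤ/p_1ℤ) × (ℤ/p_2ℤ), define maps π_1, π_2, π_3 by: π_2(j,k) = (j, k+1); π_1(j,k) = (j+1, k) if k is even and π_1(j,k) = (j−1, k−2) if k is odd; π_3(j,k) = (j, k−2j) if k is even and π_3(j,k) = (j, k+2(j−1)) if k is odd, where in π_3 the expressions 2j and 2(j−1) mean twice an integer lift of j (well-defined modulo p_2 since p_2 divides 2p_1), and parity of k ∈ ℤ/p_2ℤ is well-defined since p_2 is even. Then π_1, π_2, π_3 are bijections, and writing products as right-to-left in the exponent convention (g·h means apply g then h), they satisfy π_1^{p_1} = π_2^{p_2} = π_3^{p_3} = id, (π_1π_2)² = (π_2π_3)² = (π_1π_2π_3)² = id, π_1 commutes with π_2², and π_3 commutes with π_2²;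 moreover π_2 has order exactly p_2. -/
theorem Function.bijective_of_iterate_eq_id {α : Type*} {f : α → α} {n : ℕ} (hn : n ≠ 0)
    (h : f^[n] = id) : Function.Bijective f := by
  obtain ⟨m, rfl⟩ := Nat.exists_eq_succ_of_ne_zero hn
  refine ⟨Function.Injective.of_comp (f := f^[m]) ?_,
    Function.Surjective.of_comp (g := f^[m]) ?_⟩
  · rw [← Function.iterate_succ, h]
    exact Function.injective_id
  · rw [← Function.iterate_succ', h]
    exact Function.surjective_id

theorem ZMod.even_val_natCast {n : ℕ} (hn : Even n) (a : ℕ) :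
    Even (a : ZMod n).val ↔ Even a := by
  rw [ZMod.val_natCast, Nat.even_iff, Nat.mod_mod_of_dvd _ hn.two_dvd, ← Nat.even_iff]

theorem ZMod.even_val_add_natCast {n : ℕ} [NeZero n] (hn : Even n) (x : ZMod n) (a : ℕ) :
    Even (x + a).val ↔ (Even x.val ↔ Even a) := by
  rw [← Nat.even_add, ← ZMod.even_val_natCast hn (_ + _), Nat.cast_add, ZMod.natCast_zmod_val]

/-- Doubling an integer lift is additive in unit steps as a map `ZMod m → ZMod n` when
`n ∣ 2 * m`. -/
theorem ZMod.two_mul_val_add_one {m n : ℕ} [NeZero m] (h : n ∣ 2 * m) (x : ZMod m) :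
    ((2 * (x + 1).val : ℕ) : ZMod n) = ((2 * x.val : ℕ) : ZMod n) + 2 := by
  have hx : (x + 1).val = (x.val + 1) % m := by
    rw [← ZMod.val_natCast, Nat.cast_add, ZMod.natCast_zmod_val, Nat.cast_one]
  have hmod : 2 * (x + 1).val ≡ 2 * (x.val + 1) [MOD n] := by
    rw [hx]
    exact ((Nat.mod_modEq _ m).mul_left' 2).of_dvd h
  rw [(ZMod.natCast_eq_natCast_iff _ _ _).2 hmod]
  push_cast
  ring


/-- The explicit permutation representation of the rotation group `Γ⁺(p_1, p_2, p_3)` on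
`ℤ/p_1ℤ × ℤ/p_2ℤ` (with `p_1, p_3` odd and `p_2` an even divisor of `2p_1` and of `2p_3`):
the maps `π_1, π_2, π_3` are bijections satisfying `π_1^{p_1} = π_2^{p_2} = π_3^{p_3} = id`,
`(π_1π_2)² = (π_2π_3)² = (π_1π_2π_3)² = id` (products applied left-to-right, i.e. `g·h` means
apply `g` then `h`), `π_1` and `π_3` commute with `π_2²`, and `π_2` has order exactly `p_2`. -/
theorem permutation_representation (p1 p2 p3 : ℕ) (h1 : 3 ≤ p1) (h1odd : Odd p1)
    (h2pos : 0 < p2) (h2even : Even p2) (h2dvd1 : p2 ∣ 2 * p1)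
    (h3 : 3 ≤ p3) (h3odd : Odd p3) (h2dvd3 : p2 ∣ 2 * p3) :
    let π1 : ZMod p1 × ZMod p2 → ZMod p1 × ZMod p2 :=
      fun x => if Even x.2.val then (x.1 + 1, x.2) else (x.1 - 1, x.2 - 2)
    let π2 : ZMod p1 × ZMod p2 → ZMod p1 × ZMod p2 :=
      fun x => (x.1, x.2 + 1)
    let π3 : ZMod p1 × ZMod p2 → ZMod p1 × ZMod p2 :=
      fun x => if Even x.2.val then (x.1, x.2 - ((2 * x.1.val : ℕ) : ZMod p2))
               else (x.1, x.2 + ((2 * (x.1 - 1).val : ℕ) : ZMod p2))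
    Function.Bijective π1 ∧ Function.Bijective π2 ∧ Function.Bijective π3 ∧
    π1^[p1] = id ∧ π2^[p2] = id ∧ π3^[p3] = id ∧
    (π2 ∘ π1) ∘ (π2 ∘ π1) = id ∧
    (π3 ∘ π2) ∘ (π3 ∘ π2) = id ∧
    (π3 ∘ π2 ∘ π1) ∘ (π3 ∘ π2 ∘ π1) = id ∧
    π1 ∘ (π2 ∘ π2) = (π2 ∘ π2) ∘ π1 ∧
    π3 ∘ (π2 ∘ π2) = (π2 ∘ π2) ∘ π3 ∧
    (∀ m : ℕ, 0 < m → m < p2 → π2^[m] ≠ id) := by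
  intro π1 π2 π3
  have : NeZero p1 := ⟨by lia⟩
  have : NeZero p2 := ⟨by lia⟩
  have even_add_one (k : ZMod p2) : Even (k + 1).val ↔ ¬ Even k.val := by
    simpa using ZMod.even_val_add_natCast h2even k 1
  have even_add_double (k : ZMod p2) (n : ℕ) :
      Even (k + ((2 * n : ℕ) : ZMod p2)).val ↔ Even k.val := by
    simpa using ZMod.even_val_add_natCast h2even k (2 * n)
  have even_sub_double (k : ZMod p2) (n : ℕ) :
      Even (k - ((2 * n : ℕ) : ZMod p2)).val ↔ Even k.val := by
    rw [← even_add_double _ n, sub_add_cancel]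
  have even_sub_two (k : ZMod p2) : Even (k - 2).val ↔ Even k.val := by
    simpa using even_sub_double k 1
  have double_add_one := ZMod.two_mul_val_add_one (n := p2) h2dvd1
  have double_sub_one (j : ZMod p1) :
      ((2 * (j - 1).val : ℕ) : ZMod p2) = ((2 * j.val : ℕ) : ZMod p2) - 2 := by
    rw [eq_sub_iff_add_eq, ← double_add_one, sub_add_cancel]
  have two_mul_p1 : (2 : ZMod p2) * p1 = 0 := by
    exact_mod_cast (ZMod.natCast_eq_zero_iff _ _).2 h2dvd1
  have two_mul_p3 : (2 : ZMod p2) * p3 = 0 := by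
    exact_mod_cast (ZMod.natCast_eq_zero_iff _ _).2 h2dvd3
  have π1_even {j : ZMod p1} {k : ZMod p2} (hk : Even k.val) : π1 (j, k) = (j + 1, k) :=
    if_pos hk
  have π1_odd {j : ZMod p1} {k : ZMod p2} (hk : ¬ Even k.val) : π1 (j, k) = (j - 1, k - 2) :=
    if_neg hk
  have π2_apply (j : ZMod p1) (k : ZMod p2) : π2 (j, k) = (j, k + 1) := rfl
  have π3_even {j : ZMod p1} {k : ZMod p2} (hk : Even k.val) :
      π3 (j, k) = (j, k - ((2 * j.val : ℕ) : ZMod p2)) := if_pos hk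
  have π3_odd {j : ZMod p1} {k : ZMod p2} (hk : ¬ Even k.val) :
      π3 (j, k) = (j, k + ((2 * (j - 1).val : ℕ) : ZMod p2)) := if_neg hk
  clear_value π1 π2 π3
  have iter1_even (n : ℕ) {j : ZMod p1} {k : ZMod p2} (hk : Even k.val) :
      π1^[n] (j, k) = (j + n, k) := by
    induction n with
    | zero => simp
    | succ n ih =>
      rw [Function.iterate_succ_apply', ih, π1_even hk]
      push_cast
      ring_nf
  have iter1_odd (n : ℕ) {j : ZMod p1} {k : ZMod p2} (hk : ¬ Even k.val) :
      π1^[n] (j, k) = (j - n, k - ((2 * n : ℕ) : ZMod p2)) := by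
    induction n with
    | zero => simp
    | succ n ih =>
      rw [Function.iterate_succ_apply', ih, π1_odd (by rwa [even_sub_double])]
      push_cast
      ring_nf
  have iter2 (n : ℕ) (j : ZMod p1) (k : ZMod p2) : π2^[n] (j, k) = (j, k + n) := by
    induction n with
    | zero => simp
    | succ n ih =>
      rw [Function.iterate_succ_apply', ih, π2_apply]
      push_cast
      ring_nf
  have iter3_even (n : ℕ) {j : ZMod p1} {k : ZMod p2} (hk : Even k.val) :
      π3^[n] (j, k) = (j, k - ((2 * (n * j.val) : ℕ) : ZMod p2)) := by
    induction n with
    | zero => simp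
    | succ n ih =>
      rw [Function.iterate_succ_apply', ih, π3_even (by rwa [even_sub_double])]
      push_cast
      ring_nf
  have iter3_odd (n : ℕ) {j : ZMod p1} {k : ZMod p2} (hk : ¬ Even k.val) :
      π3^[n] (j, k) = (j, k + ((2 * (n * (j - 1).val) : ℕ) : ZMod p2)) := by
    induction n with
    | zero => simp
    | succ n ih =>
      rw [Function.iterate_succ_apply', ih, π3_odd (by rwa [even_add_double])]
      push_cast
      ring_nf
  have pow1 : π1^[p1] = id := by
    funext ⟨j, k⟩
    by_cases hk : Even k.val
    · simp [iter1_even _ hk]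
    · simp [iter1_odd _ hk, two_mul_p1]
  have pow2 : π2^[p2] = id := by
    funext ⟨j, k⟩
    simp [iter2]
  have pow3 : π3^[p3] = id := by
    funext ⟨j, k⟩
    by_cases hk : Even k.val
    · simp [iter3_even _ hk, ← mul_assoc, two_mul_p3]
    · simp [iter3_odd _ hk, ← mul_assoc, two_mul_p3]
  refine ⟨Function.bijective_of_iterate_eq_id (by lia) pow1,
    Function.bijective_of_iterate_eq_id (by lia) pow2,
    Function.bijective_of_iterate_eq_id (by lia) pow3, pow1, pow2, pow3, ?_, ?_, ?_, ?_, ?_, ?_⟩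
  iterate 5
    · funext ⟨j, k⟩
      by_cases hk : Even k.val <;>
        simp only [Function.comp_apply, id_eq, π2_apply, π1_even, π1_odd, π3_even, π3_odd, hk,
          even_add_one, even_sub_two, even_add_double, even_sub_double, not_true_eq_false,
          not_false_eq_true] <;>
        refine Prod.ext ?_ ?_ <;> try simp only [double_add_one, double_sub_one]
      all_goals ring
  · intro m hm hlt h
    have h0 := congrArg Prod.snd (congrFun h (0, 0))
    rw [iter2, zero_add] at h0
    exact Nat.not_dvd_of_pos_of_lt hm hlt ((ZMod.natCast_eq_zero_iff _ _).1 h0)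
end

section
/- Let p_1 ≥ 3 and p_4 ≥ 3 be odd, let p_2 be an even positive integer dividing 2p_1, and let p_3 be an even positive integer dividing 2p_4. Then Γ(p_1, p_2, p_3, p_4), with its generating involutions x_0, x_1, x_2, x_3, x_4, satisfies the intersection condition; the element x_{i−1}x_i has order exactly p_i for 1 ≤ i ≤ 4; the order of Γ(p_1, p_2, p_3, p_4) equals 2 p_1 p_2 p_3 p_4; and the subgroup generated by x_0x_1, x_1x_2, x_2x_3, x_3x_4 has index 2. -/
/-- The function recording the tuple `(p_1, p_2, p_3, p_4)`. -/
def pfun4 (p1 p2 p3 p4 : ℕ) : ℕ → ℕ :=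
  fun i => if i = 1 then p1 else if i = 2 then p2 else if i = 3 then p3
           else if i = 4 then p4 else 2

section Factorization

variable {G : Type*} [Group G]

/-- Two generating sets which commute modulo a normal subgroup `U` give a factorization of the
group they generate together. -/
theorem exists_factorization_of_commute_mod {U : Subgroup G} [U.Normal] {T W : Set G}
    (h : ∀ w ∈ W, ∀ t ∈ T, w * t * w⁻¹ * t⁻¹ ∈ U) {g : G} (hg : g ∈ Subgroup.closure (T ∪ W)) :
    ∃ d ∈ Subgroup.closure T, ∃ u ∈ U, ∃ w ∈ Subgroup.closure W, g = d * u * w := by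
  let q := QuotientGroup.mk' U
  have hcomm : ∀ w ∈ Subgroup.closure W, ∀ t ∈ Subgroup.closure T, Commute (q w) (q t) := by
    have hle : Subgroup.closure W ≤ (Subgroup.centralizer (q '' T)).comap q := by
      rw [Subgroup.closure_le]
      rintro w hw
      rw [SetLike.mem_coe, Subgroup.mem_comap, Subgroup.mem_centralizer_iff]
      rintro _ ⟨t, ht, rfl⟩
      have := (QuotientGroup.eq_one_iff _).2 (h w hw t ht)
      change q (w * t * w⁻¹ * t⁻¹) = 1 at this
      rw [map_mul, map_mul, map_mul, map_inv, map_inv, mul_inv_eq_one,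
        mul_inv_eq_iff_eq_mul] at this
      exact this.symm
    intro w hw t ht
    have h1 := hle hw
    rw [Subgroup.mem_comap, ← Subgroup.centralizer_closure, Subgroup.mem_centralizer_iff,
      ← MonoidHom.map_closure] at h1
    exact (h1 _ (Subgroup.mem_map_of_mem q ht)).symm
  have key : ∃ d ∈ Subgroup.closure T, ∃ w ∈ Subgroup.closure W, q g = q d * q w := by
    induction hg using Subgroup.closure_induction with
    | mem x hx =>
      rcases hx with hx | hx
      · exact ⟨x, Subgroup.subset_closure hx, 1, one_mem _, by simp⟩
      · exact ⟨1, one_mem _, x, Subgroup.subset_closure hx, by simp⟩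
    | one => exact ⟨1, one_mem _, 1, one_mem _, by simp⟩
    | mul x y _ _ hx hy =>
      obtain ⟨d, hd, w, hw, e⟩ := hx
      obtain ⟨d', hd', w', hw', e'⟩ := hy
      refine ⟨d * d', mul_mem hd hd', w * w', mul_mem hw hw', ?_⟩
      rw [map_mul, map_mul, map_mul, e, e', mul_assoc, ← mul_assoc (q w),
        (hcomm w hw d' hd').eq]
      simp only [mul_assoc]
    | inv x _ hx =>
      obtain ⟨d, hd, w, hw, e⟩ := hx
      refine ⟨d⁻¹, inv_mem hd, w⁻¹, inv_mem hw, ?_⟩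
      rw [map_inv, e, (hcomm w hw d hd).symm.eq, map_inv, map_inv, mul_inv_rev]
  obtain ⟨d, hd, w, hw, e⟩ := key
  refine ⟨d, hd, d⁻¹ * g * w⁻¹, ?_, w, hw, by group⟩
  rw [← QuotientGroup.eq_one_iff]
  change q (d⁻¹ * g * w⁻¹) = 1
  simp [e]

theorem mem_closure_singleton_of_sq_eq_one {x g : G} (hx : x ^ 2 = 1)
    (hg : g ∈ Subgroup.closure {x}) : g = 1 ∨ g = x := by
  obtain ⟨k, rfl⟩ := Subgroup.mem_closure_singleton.1 hg
  rcases Int.even_or_odd' k with ⟨m, rfl | rfl⟩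
  · left; rw [zpow_mul, zpow_ofNat, hx, one_zpow]
  · right; rw [zpow_add, zpow_mul, zpow_ofNat, hx, one_zpow, one_mul, zpow_one]

/-- The intersection condition for two involutions. -/
theorem closure_inf_le_of_subset_pair {ι : Type*} {x : ι → G} {i j : ι} (hi : x i ^ 2 = 1)
    (hj : x j ^ 2 = 1) (hij : i ≠ j → x i ≠ x j) {A B : Set ι} (hA : A ⊆ {i, j})
    (hB : B ⊆ {i, j}) :
    Subgroup.closure (x '' A) ⊓ Subgroup.closure (x '' B) ≤ Subgroup.closure (x '' (A ∩ B)) := by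
  by_cases hAB : A ⊆ B
  · rw [Set.inter_eq_left.2 hAB]; exact inf_le_left
  by_cases hBA : B ⊆ A
  · rw [Set.inter_eq_right.2 hBA]; exact inf_le_right
  obtain ⟨a, haA, haB⟩ := Set.not_subset.1 hAB
  obtain ⟨b, hbB, hbA⟩ := Set.not_subset.1 hBA
  have hab : a ≠ b := fun h => haB (h ▸ hbB)
  have hA' : A = {a} := by
    ext c; have := @hA c; have := hA haA; have := hB hbB; simp at *; grind
  have hB' : B = {b} := by
    ext c; have := @hB c; have := hA haA; have := hB hbB; simp at *; grind
  have hx : x a ≠ x b ∧ x a ^ 2 = 1 ∧ x b ^ 2 = 1 := by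
    have := hA haA; have := hB hbB; simp at *; grind
  intro g hg
  rw [Subgroup.mem_inf, hA', hB', Set.image_singleton, Set.image_singleton] at hg
  have h1 := mem_closure_singleton_of_sq_eq_one hx.2.1 hg.1
  have h2 := mem_closure_singleton_of_sq_eq_one hx.2.2 hg.2
  have : g = 1 := by
    rcases h1 with h1 | h1
    · exact h1
    · rcases h2 with h2 | h2
      · exact h2
      · exact absurd (h1.symm.trans h2) hx.1
  rw [this]; exact one_mem _

theorem exists_mul_zpow_of_mem_closure_pair {c y g : G} (h : y * c * y⁻¹ = c⁻¹)
    (hg : g ∈ Subgroup.closure {c, y}) :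
    ∃ d ∈ Subgroup.zpowers c, ∃ e ∈ Subgroup.zpowers y, g = d * e := by
  have hy : ∀ k l : ℤ, ∃ m : ℤ, y ^ k * c ^ l = c ^ m * y ^ k := by
    have hconj : ∀ l : ℤ, SemiconjBy y (c ^ l) (c ^ (-l)) := fun l => by
      have : SemiconjBy y c c⁻¹ := by rw [SemiconjBy, ← h]; group
      simpa using this.zpow_right l
    intro k
    induction k using Int.induction_on with
    | zero => intro l; exact ⟨l, by simp⟩
    | succ k ih =>
      intro l
      obtain ⟨m, hm⟩ := ih (-l)
      refine ⟨m, ?_⟩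
      rw [zpow_add_one, mul_assoc, (hconj l).eq, ← mul_assoc, hm, mul_assoc]
    | pred k ih =>
      intro l
      obtain ⟨m, hm⟩ := ih (-l)
      refine ⟨m, ?_⟩
      have := (hconj (-l)).inv_symm_left
      rw [neg_neg] at this
      rw [zpow_sub_one, mul_assoc, this.eq, ← mul_assoc, hm, mul_assoc]
  simp only [Subgroup.mem_zpowers_iff]
  induction hg using Subgroup.closure_induction with
  | mem x hx =>
    rcases hx with rfl | rfl
    · exact ⟨x, ⟨1, by simp⟩, 1, ⟨0, by simp⟩, by simp⟩
    · exact ⟨1, ⟨0, by simp⟩, x, ⟨1, by simp⟩, by simp⟩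
  | one => exact ⟨1, ⟨0, by simp⟩, 1, ⟨0, by simp⟩, by simp⟩
  | mul x z _ _ hx hz =>
    obtain ⟨_, ⟨i, rfl⟩, _, ⟨j, rfl⟩, rfl⟩ := hx
    obtain ⟨_, ⟨k, rfl⟩, _, ⟨l, rfl⟩, rfl⟩ := hz
    obtain ⟨m, hm⟩ := hy j k
    refine ⟨_, ⟨i + m, rfl⟩, _, ⟨j + l, rfl⟩, ?_⟩
    rw [mul_assoc, ← mul_assoc (y ^ j), hm, zpow_add, zpow_add]
    simp only [mul_assoc]
  | inv x _ hx =>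
    obtain ⟨_, ⟨i, rfl⟩, _, ⟨j, rfl⟩, rfl⟩ := hx
    obtain ⟨m, hm⟩ := hy (-j) (-i)
    exact ⟨_, ⟨m, rfl⟩, _, ⟨-j, rfl⟩, by rw [← hm, mul_inv_rev, zpow_neg, zpow_neg]⟩

theorem zpowers_normal_of_closure_eq_top {T : Set G} (hT : Subgroup.closure T = ⊤) {t : G}
    (h : ∀ x ∈ T, x * t * x⁻¹ = t ∨ x * t * x⁻¹ = t⁻¹) : (Subgroup.zpowers t).Normal := by
  have key : ∀ g : G, g * t * g⁻¹ = t ∨ g * t * g⁻¹ = t⁻¹ := by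
    intro g
    have hg : g ∈ Subgroup.closure T := hT ▸ Subgroup.mem_top g
    induction hg using Subgroup.closure_induction with
    | mem x hx => exact h x hx
    | one => simp
    | mul x y _ _ hx hy =>
      have e : x * y * t * (x * y)⁻¹ = x * (y * t * y⁻¹) * x⁻¹ := by group
      rw [e]
      rcases hy with hy | hy <;> rw [hy]
      · exact hx
      · rw [← conj_inv, inv_inj, inv_eq_iff_eq_inv]
        exact hx.symm
    | inv x _ hx =>
      rcases hx with hx | hx
      · left; nth_rw 1 [← hx]; group
      · right
        have e : x⁻¹ * t * x⁻¹⁻¹ = (x⁻¹ * t⁻¹ * x)⁻¹ := by group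
        rw [e, inv_inj, ← hx]; group
  refine ⟨?_⟩
  rintro _ ⟨k, rfl⟩ g
  change g * t ^ k * g⁻¹ ∈ _
  rw [← conj_zpow]
  rcases key g with e | e <;> rw [e]
  · exact zpow_mem (Subgroup.mem_zpowers t) k
  · exact zpow_mem (inv_mem (Subgroup.mem_zpowers t)) k

end Factorization
/-- Five elements of a group satisfying the defining relations of `Γ(p1, p2, p3, p4)` with `p1`
and `p4` odd and `p2` and `p3` even. -/
structure IsGammaFamily {G : Type*} [Group G] (p1 p2 p3 p4 : ℕ) (y : Fin 5 → G) : Prop where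
  sq_eq_one : ∀ i, y i ^ 2 = 1
  pow_one : (y 0 * y 1) ^ p1 = 1
  pow_two : (y 1 * y 2) ^ p2 = 1
  pow_three : (y 2 * y 3) ^ p3 = 1
  pow_four : (y 3 * y 4) ^ p4 = 1
  comm : ∀ i j : Fin 5, (i : ℕ) + 2 ≤ (j : ℕ) → (y i * y j) ^ 2 = 1
  left : (y 0 * y 1 * y 2 * y 1 * y 2) ^ 2 = 1
  middle : (y 1 * y 2 * y 3 * y 2) ^ 2 = 1
  right : (y 4 * y 3 * y 2 * y 3 * y 2) ^ 2 = 1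

theorem isGammaFamily_xg {p1 p2 p3 p4 : ℕ} (h1 : Odd p1) (h2 : Even p2) (h3 : Even p3)
    (h4 : Odd p4) : IsGammaFamily p1 p2 p3 p4 (xg 5 (pfun4 p1 p2 p3 p4)) := by
  have key : ∀ w ∈ gammaRels 5 (pfun4 p1 p2 p3 p4),
      PresentedGroup.mk (gammaRels 5 (pfun4 p1 p2 p3 p4)) w = 1 := fun w hw =>
    PresentedGroup.one_of_mem hw
  refine ⟨fun i => key _ (Or.inl ⟨i, rfl⟩),
    key _ (Or.inr (Or.inl ⟨0, 1, rfl, rfl⟩)), key _ (Or.inr (Or.inl ⟨1, 2, rfl, rfl⟩)),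
    key _ (Or.inr (Or.inl ⟨2, 3, rfl, rfl⟩)), key _ (Or.inr (Or.inl ⟨3, 4, rfl, rfl⟩)),
    fun i j h => key _ (Or.inr (Or.inr (Or.inl ⟨i, j, h, rfl⟩))),
    key _ (Or.inr (Or.inr (Or.inr ⟨0, 1, 2, rfl, rfl, Or.inr (Or.inl ⟨h1, h2, rfl⟩)⟩))),
    key _ (Or.inr (Or.inr (Or.inr ⟨1, 2, 3, rfl, rfl, Or.inl ⟨h2, h3, rfl⟩⟩))),
    key _ (Or.inr (Or.inr (Or.inr ⟨2, 3, 4, rfl, rfl, Or.inr (Or.inr ⟨h3, h4, rfl⟩)⟩)))⟩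

theorem IsGammaFamily.exists_hom {G : Type*} [Group G] {p1 p2 p3 p4 : ℕ} {y : Fin 5 → G}
    (hy : IsGammaFamily p1 p2 p3 p4 y) (h1 : Odd p1) (h2 : Even p2) (h3 : Even p3) (h4 : Odd p4) :
    ∃ f : Gamma 5 (pfun4 p1 p2 p3 p4) →* G, ∀ i, f (xg 5 _ i) = y i := by
  have n1 := Nat.not_even_iff_odd.2 h1
  have n2 := Nat.not_odd_iff_even.2 h2
  have n3 := Nat.not_odd_iff_even.2 h3
  have n4 := Nat.not_even_iff_odd.2 h4
  have key : ∀ w ∈ gammaRels 5 (pfun4 p1 p2 p3 p4), FreeGroup.lift y w = 1 := by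
    rintro w (⟨i, rfl⟩ | ⟨i, j, hij, rfl⟩ | ⟨i, j, hij, rfl⟩ | ⟨a, b, c, hab, hbc, h⟩)
    · simpa using hy.sq_eq_one i
    · obtain ⟨i, hi⟩ := i
      obtain ⟨j, hj⟩ := j
      obtain rfl : i + 1 = j := hij
      obtain rfl | rfl | rfl | rfl : i = 0 ∨ i = 1 ∨ i = 2 ∨ i = 3 := by omega
      · simpa [pfun4] using hy.pow_one
      · simpa [pfun4] using hy.pow_two
      · simpa [pfun4] using hy.pow_three
      · simpa [pfun4] using hy.pow_four
    · simpa using hy.comm i j hij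
    · obtain ⟨a, ha⟩ := a
      obtain ⟨b, hb⟩ := b
      obtain ⟨c, hc⟩ := c
      obtain rfl : a + 1 = b := hab
      obtain rfl : a + 1 + 1 = c := hbc
      obtain rfl | rfl | rfl : a = 0 ∨ a = 1 ∨ a = 2 := by omega
      · rcases h with ⟨h, -⟩ | ⟨-, -, rfl⟩ | ⟨h, -⟩
        · exact absurd h n1
        · simpa using hy.left
        · exact absurd h n1
      · rcases h with ⟨-, -, rfl⟩ | ⟨h, -⟩ | ⟨-, h, -⟩
        · simpa using hy.middle
        · exact absurd h n2
        · exact absurd h n3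
      · rcases h with ⟨-, h, -⟩ | ⟨h, -⟩ | ⟨-, -, rfl⟩
        · exact absurd h n4
        · exact absurd h n3
        · simpa using hy.right
  exact ⟨PresentedGroup.toGroup key, fun i => PresentedGroup.toGroup.of key⟩

namespace IsGammaFamily

variable {G : Type*} [Group G] {p1 p2 p3 p4 : ℕ} {x : Fin 5 → G}

theorem mul_self (hx : IsGammaFamily p1 p2 p3 p4 x) (i : Fin 5) : x i * x i = 1 := by
  rw [← sq, hx.sq_eq_one]

theorem inv_eq (hx : IsGammaFamily p1 p2 p3 p4 x) (i : Fin 5) : (x i)⁻¹ = x i :=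
  inv_eq_of_mul_eq_one_left (hx.mul_self i)

theorem commute (hx : IsGammaFamily p1 p2 p3 p4 x) {i j : Fin 5} (h : (i : ℕ) + 2 ≤ (j : ℕ)) :
    Commute (x i) (x j) := by
  have := hx.comm i j h
  rw [sq, mul_eq_one_iff_eq_inv, mul_inv_rev, hx.inv_eq, hx.inv_eq] at this
  exact this

theorem conj_left (hx : IsGammaFamily p1 p2 p3 p4 x) (i : Fin 5) :
    x i * (x 1 * x 2) ^ 2 * (x i)⁻¹ = (x 1 * x 2) ^ 2 ∨
      x i * (x 1 * x 2) ^ 2 * (x i)⁻¹ = ((x 1 * x 2) ^ 2)⁻¹ := by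
  have h1 := hx.mul_self 1
  have h2 := hx.mul_self 2
  have c13 := hx.commute (i := 1) (j := 3) (by decide)
  have c14 := hx.commute (i := 1) (j := 4) (by decide)
  have c24 := hx.commute (i := 2) (j := 4) (by decide)
  fin_cases i
  · right
    have := hx.left
    rw [eq_inv_iff_mul_eq_one, hx.inv_eq, ← this]
    simp [sq, mul_assoc]
  · right
    rw [eq_inv_iff_mul_eq_one, hx.inv_eq]
    simp only [sq, mul_assoc]
    simp [← mul_assoc (x 1) (x 1), ← mul_assoc (x 2) (x 2), h1, h2]
  · right
    rw [eq_inv_iff_mul_eq_one, hx.inv_eq]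
    simp only [sq, mul_assoc]
    simp [← mul_assoc (x 1) (x 1), ← mul_assoc (x 2) (x 2), h1, h2]
  · left
    have hc : Commute (x 3) (x 2 * x 1 * x 2) := by
      have := hx.middle
      have e : (x 1 * x 2 * x 3 * x 2) ^ 2 =
          x 1 * (x 2 * x 3 * x 2) * (x 1 * (x 2 * x 3 * x 2)) := by
        simp only [sq, mul_assoc]
      rw [e, mul_eq_one_iff_eq_inv] at this
      simp only [mul_inv_rev, hx.inv_eq] at this
      have h := congrArg (fun g => x 2 * g * x 2) this
      simp only [mul_assoc, h2, mul_one] at h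
      simp only [← mul_assoc, h2, one_mul] at h
      simp only [Commute, SemiconjBy, ← mul_assoc]
      exact h.symm
    rw [mul_inv_eq_iff_eq_mul]
    have e : (x 1 * x 2) ^ 2 = x 1 * (x 2 * x 1 * x 2) := by simp only [sq, mul_assoc]
    rw [e]
    exact (c13.symm.mul_right hc).eq
  · left
    rw [mul_inv_eq_iff_eq_mul]
    exact (((c14.mul_left c24).pow_left 2).symm).eq

/-- The relations are invariant under reversing the order of the generators. -/
theorem reverse (hx : IsGammaFamily p1 p2 p3 p4 x) :
    IsGammaFamily p4 p3 p2 p1 ![x 4, x 3, x 2, x 1, x 0] := by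
  have hinv : ∀ (i j : Fin 5) (n : ℕ), (x i * x j) ^ n = 1 → (x j * x i) ^ n = 1 := by
    intro i j n h
    rw [← inv_eq_one, ← inv_pow, mul_inv_rev, hx.inv_eq, hx.inv_eq] at h
    exact h
  refine ⟨?_, hinv _ _ _ hx.pow_four, hinv _ _ _ hx.pow_three, hinv _ _ _ hx.pow_two,
    hinv _ _ _ hx.pow_one, ?_, hx.right, ?_, hx.left⟩
  · intro i; fin_cases i <;> exact hx.sq_eq_one _
  · intro i j h
    fin_cases i <;> fin_cases j <;> simp at h <;>
      exact hinv _ _ _ (hx.comm _ _ (by decide))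
  · change (x 3 * x 2 * x 1 * x 2) ^ 2 = 1
    have := hx.middle
    rw [← inv_eq_one, ← inv_pow] at this
    simp only [mul_inv_rev, hx.inv_eq] at this
    have e : (x 3 * x 2 * x 1 * x 2) ^ 2
        = (x 2)⁻¹ * (x 2 * (x 3 * (x 2 * x 1))) ^ 2 * (x 2)⁻¹⁻¹ := by
      rw [← conj_pow]; group
    rw [e, this]; simp

theorem conj_right (hx : IsGammaFamily p1 p2 p3 p4 x) (i : Fin 5) :
    x i * (x 2 * x 3) ^ 2 * (x i)⁻¹ = (x 2 * x 3) ^ 2 ∨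
      x i * (x 2 * x 3) ^ 2 * (x i)⁻¹ = ((x 2 * x 3) ^ 2)⁻¹ := by
  have e : (x 2 * x 3) ^ 2 = ((x 3 * x 2) ^ 2)⁻¹ := by
    rw [← inv_pow, mul_inv_rev, hx.inv_eq, hx.inv_eq]
  have h : x i * (x 3 * x 2) ^ 2 * (x i)⁻¹ = (x 3 * x 2) ^ 2 ∨
      x i * (x 3 * x 2) ^ 2 * (x i)⁻¹ = ((x 3 * x 2) ^ 2)⁻¹ := by
    have := hx.reverse.conj_left i.rev
    fin_cases i <;> exact this
  rw [e, ← conj_inv, inv_inj, inv_inj]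
  exact h

theorem exists_normal_left (hx : IsGammaFamily p1 p2 p3 p4 x)
    (hgen : Subgroup.closure (Set.range x) = ⊤) (I : Set (Fin 5)) :
    ∃ U : Subgroup G, U.Normal ∧
      (∀ u ∈ U, u ∈ Subgroup.zpowers ((x 1 * x 2) ^ 2) ∧ (u = 1 ∨ 1 ∈ I ∧ 2 ∈ I)) ∧
      (1 ∈ I → 2 ∈ I → (x 1 * x 2) ^ 2 ∈ U) := by
  by_cases h : 1 ∈ I ∧ 2 ∈ I
  · refine ⟨Subgroup.zpowers ((x 1 * x 2) ^ 2), zpowers_normal_of_closure_eq_top hgen ?_,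
      fun u hu => ⟨hu, Or.inr h⟩, fun _ _ => Subgroup.mem_zpowers _⟩
    rintro _ ⟨i, rfl⟩
    exact hx.conj_left i
  · refine ⟨⊥, inferInstance, ?_, fun h1 h2 => absurd ⟨h1, h2⟩ h⟩
    intro u hu
    rw [Subgroup.mem_bot] at hu
    subst hu
    exact ⟨one_mem _, Or.inl rfl⟩

theorem exists_normal_right (hx : IsGammaFamily p1 p2 p3 p4 x)
    (hgen : Subgroup.closure (Set.range x) = ⊤) (I : Set (Fin 5)) :
    ∃ V : Subgroup G, V.Normal ∧
      (∀ v ∈ V, v ∈ Subgroup.zpowers ((x 2 * x 3) ^ 2) ∧ (v = 1 ∨ 2 ∈ I ∧ 3 ∈ I)) ∧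
      (2 ∈ I → 3 ∈ I → (x 2 * x 3) ^ 2 ∈ V) := by
  by_cases h : 2 ∈ I ∧ 3 ∈ I
  · refine ⟨Subgroup.zpowers ((x 2 * x 3) ^ 2), zpowers_normal_of_closure_eq_top hgen ?_,
      fun u hu => ⟨hu, Or.inr h⟩, fun _ _ => Subgroup.mem_zpowers _⟩
    rintro _ ⟨i, rfl⟩
    exact hx.conj_right i
  · refine ⟨⊥, inferInstance, ?_, fun h1 h2 => absurd ⟨h1, h2⟩ h⟩
    intro u hu
    rw [Subgroup.mem_bot] at hu
    subst hu
    exact ⟨one_mem _, Or.inl rfl⟩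

theorem exists_factorization (hx : IsGammaFamily p1 p2 p3 p4 x)
    (hgen : Subgroup.closure (Set.range x) = ⊤) {I : Set (Fin 5)} {g : G}
    (hg : g ∈ Subgroup.closure (x '' I)) :
    ∃ d ∈ Subgroup.closure (x '' (I ∩ {0, 1})),
    ∃ u ∈ Subgroup.zpowers ((x 1 * x 2) ^ 2), (u = 1 ∨ 1 ∈ I ∧ 2 ∈ I) ∧
    ∃ w ∈ Subgroup.closure (x '' (I ∩ {2})),
    ∃ v ∈ Subgroup.zpowers ((x 2 * x 3) ^ 2), (v = 1 ∨ 2 ∈ I ∧ 3 ∈ I) ∧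
    ∃ e ∈ Subgroup.closure (x '' (I ∩ {3, 4})), g = d * u * w * v * e := by
  obtain ⟨U, hUn, hU, hU'⟩ := hx.exists_normal_left hgen I
  obtain ⟨V, hVn, hV, hV'⟩ := hx.exists_normal_right hgen I
  have hcomm : ∀ {i j : Fin 5} {K : Subgroup G}, (j : ℕ) + 2 ≤ (i : ℕ) →
      x i * x j * (x i)⁻¹ * (x j)⁻¹ ∈ K := by
    intro i j K h
    rw [(hx.commute h).symm.eq]
    simp
  have hI : x '' I = x '' (I ∩ {0, 1}) ∪ (x '' (I ∩ {2}) ∪ x '' (I ∩ {3, 4})) := by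
    rw [← Set.image_union, ← Set.image_union, ← Set.inter_union_distrib_left,
      ← Set.inter_union_distrib_left]
    congr 1
    rw [eq_comm, Set.inter_eq_left]
    intro i _
    fin_cases i <;> simp
  rw [hI] at hg
  obtain ⟨d, hd, u, hu, h, hh, rfl⟩ := exists_factorization_of_commute_mod (U := U) (by
    rintro _ (⟨i, ⟨hiI, hi⟩, rfl⟩ | ⟨i, ⟨hiI, hi⟩, rfl⟩) _ ⟨j, ⟨hjI, hj⟩, rfl⟩
    · obtain rfl : i = 2 := hi
      obtain rfl | rfl : j = 0 ∨ j = 1 := hj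
      · exact hcomm (by decide)
      · have := inv_mem (hU' hjI hiI)
        rw [← inv_pow, mul_inv_rev] at this
        simpa only [hx.inv_eq, sq, mul_assoc] using this
    · obtain rfl | rfl : i = 3 ∨ i = 4 := hi <;> obtain rfl | rfl : j = 0 ∨ j = 1 := hj <;>
        exact hcomm (by decide)) hg
  obtain ⟨w, hw, v, hv, e, he, rfl⟩ := exists_factorization_of_commute_mod (U := V) (by
    rintro _ ⟨i, ⟨hiI, hi⟩, rfl⟩ _ ⟨j, ⟨hjI, hj⟩, rfl⟩
    obtain rfl : j = 2 := hj
    obtain rfl | rfl : i = 3 ∨ i = 4 := hi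
    · have := inv_mem (hV' hjI hiI)
      rw [← inv_pow, mul_inv_rev] at this
      simpa only [hx.inv_eq, sq, mul_assoc] using this
    · exact hcomm (by decide)) hh
  exact ⟨d, hd, u, (hU u hu).1, (hU u hu).2, w, hw, v, (hV v hv).1, (hV v hv).2, e, he,
    by simp only [mul_assoc]⟩

theorem pow_eq_one_of_even (hx : IsGammaFamily p1 p2 p3 p4 x) {n : ℕ} (hn : Even n) (i : Fin 5) :
    x i ^ n = 1 := by
  obtain ⟨k, rfl⟩ := hn
  rw [← two_mul, pow_mul, hx.sq_eq_one, one_pow]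

theorem restrict_zero_one (hx : IsGammaFamily p1 p2 p3 p4 x) (h2 : Even p2) :
    IsGammaFamily p1 p2 p3 p4 ![x 0, x 1, 1, 1, 1] where
  sq_eq_one i := by fin_cases i <;> simp [hx.sq_eq_one]
  pow_one := hx.pow_one
  pow_two := by simpa using hx.pow_eq_one_of_even h2 1
  pow_three := by simp
  pow_four := by simp
  comm i j h := by fin_cases i <;> fin_cases j <;> simp [hx.sq_eq_one] at h ⊢
  left := by simp [mul_assoc, hx.mul_self, hx.sq_eq_one]
  middle := by simp [hx.sq_eq_one]
  right := by simp

theorem restrict_one (hx : IsGammaFamily p1 p2 p3 p4 x) (h2 : Even p2) :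
    IsGammaFamily p1 p2 p3 p4 ![x 1, x 1, 1, 1, 1] where
  sq_eq_one i := by fin_cases i <;> simp [hx.sq_eq_one]
  pow_one := by simp [hx.mul_self]
  pow_two := by simpa using hx.pow_eq_one_of_even h2 1
  pow_three := by simp
  pow_four := by simp
  comm i j h := by fin_cases i <;> fin_cases j <;> simp [hx.sq_eq_one] at h ⊢
  left := by simp [hx.mul_self, hx.sq_eq_one]
  middle := by simp [hx.sq_eq_one]
  right := by simp

theorem restrict_two (hx : IsGammaFamily p1 p2 p3 p4 x) (h2 : Even p2) (h3 : Even p3) :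
    IsGammaFamily p1 p2 p3 p4 ![1, 1, x 2, 1, 1] where
  sq_eq_one i := by fin_cases i <;> simp [hx.sq_eq_one]
  pow_one := by simp
  pow_two := by simpa using hx.pow_eq_one_of_even h2 2
  pow_three := by simpa using hx.pow_eq_one_of_even h3 2
  pow_four := by simp
  comm i j h := by fin_cases i <;> fin_cases j <;> simp [hx.sq_eq_one] at h ⊢
  left := by simp [hx.mul_self]
  middle := by simp [hx.mul_self]
  right := by simp [hx.mul_self]

theorem restrict_zero_one_two (hx : IsGammaFamily p1 p2 p3 p4 x) (h3 : Even p3) :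
    IsGammaFamily p1 p2 p3 p4 ![x 0, x 1, x 2, 1, 1] where
  sq_eq_one i := by fin_cases i <;> simp [hx.sq_eq_one]
  pow_one := hx.pow_one
  pow_two := hx.pow_two
  pow_three := by simpa using hx.pow_eq_one_of_even h3 2
  pow_four := by simp
  comm i j h := by
    fin_cases i <;> fin_cases j <;> simp [hx.sq_eq_one] at h ⊢
    exact hx.comm 0 2 (by decide)
  left := hx.left
  middle := by simp [mul_assoc, hx.mul_self, hx.sq_eq_one]
  right := by simp [hx.mul_self]

theorem restrict_three_four (hx : IsGammaFamily p1 p2 p3 p4 x) (h3 : Even p3) :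
    IsGammaFamily p1 p2 p3 p4 ![1, 1, 1, x 3, x 4] := by
  simpa using (hx.reverse.restrict_zero_one h3).reverse

theorem restrict_three (hx : IsGammaFamily p1 p2 p3 p4 x) (h3 : Even p3) :
    IsGammaFamily p1 p2 p3 p4 ![1, 1, 1, x 3, x 3] := by
  simpa using (hx.reverse.restrict_one h3).reverse

theorem exists_projections (hx : IsGammaFamily p1 p2 p3 p4 x) (h2 : Even p2) (h3 : Even p3)
    (hlift : ∀ y : Fin 5 → G, IsGammaFamily p1 p2 p3 p4 y → ∃ f : G →* G, ∀ i, f (x i) = y i) :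
    ∃ f01 f2 f34 f012 : G →* G,
      ∀ d ∈ Subgroup.closure (x '' {0, 1}), ∀ u ∈ Subgroup.zpowers ((x 1 * x 2) ^ 2),
      ∀ w ∈ Subgroup.closure (x '' {2}), ∀ v ∈ Subgroup.zpowers ((x 2 * x 3) ^ 2),
      ∀ e ∈ Subgroup.closure (x '' {3, 4}),
        f01 (d * u * w * v * e) = d ∧ f2 (d * u * w * v * e) = w ∧
        f34 (d * u * w * v * e) = e ∧ f012 (d * u * w * v * e) = d * u * w := by
  have hfix : ∀ (f : G →* G) (S : Set (Fin 5)), (∀ i ∈ S, f (x i) = x i) →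
      ∀ g ∈ Subgroup.closure (x '' S), f g = g := fun f S h g hg =>
    MonoidHom.eqOn_closure (f := f) (g := MonoidHom.id G)
      (by rintro _ ⟨i, hi, rfl⟩; exact h i hi) hg
  have hkill : ∀ (f : G →* G) (S : Set (Fin 5)), (∀ i ∈ S, f (x i) = 1) →
      ∀ g ∈ Subgroup.closure (x '' S), f g = 1 := fun f S h g hg =>
    MonoidHom.eqOn_closure (f := f) (g := 1) (by rintro _ ⟨i, hi, rfl⟩; exact h i hi) hg
  have hz : ∀ (f : G →* G) (t : G), f t = 1 → ∀ g ∈ Subgroup.zpowers t, f g = 1 := by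
    rintro f t h _ ⟨k, rfl⟩
    simp [h]
  have hzfix : ∀ (f : G →* G) (t : G), f t = t → ∀ g ∈ Subgroup.zpowers t, f g = g := by
    rintro f t h _ ⟨k, rfl⟩
    simp [h]
  obtain ⟨f01, h01⟩ := hlift _ (hx.restrict_zero_one h2)
  obtain ⟨f2, h2'⟩ := hlift _ (hx.restrict_two h2 h3)
  obtain ⟨f34, h34⟩ := hlift _ (hx.restrict_three_four h3)
  obtain ⟨f012, h012⟩ := hlift _ (hx.restrict_zero_one_two h3)
  refine ⟨f01, f2, f34, f012, fun d hd u hu w hw v hv e he => ⟨?_, ?_, ?_, ?_⟩⟩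
  · rw [map_mul, map_mul, map_mul, map_mul, hfix f01 _ (by simp [h01]) d hd,
      hz f01 _ (by simp [h01, hx.sq_eq_one]) u hu, hkill f01 _ (by simp [h01]) w hw,
      hz f01 _ (by simp [h01]) v hv, hkill f01 _ (by simp [h01]) e he]
    simp
  · rw [map_mul, map_mul, map_mul, map_mul, hkill f2 _ (by simp [h2']) d hd,
      hz f2 _ (by simp [h2', hx.sq_eq_one]) u hu, hfix f2 _ (by simp [h2']) w hw,
      hz f2 _ (by simp [h2', hx.sq_eq_one]) v hv, hkill f2 _ (by simp [h2']) e he]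
    simp
  · rw [map_mul, map_mul, map_mul, map_mul, hkill f34 _ (by simp [h34]) d hd,
      hz f34 _ (by simp [h34]) u hu, hkill f34 _ (by simp [h34]) w hw,
      hz f34 _ (by simp [h34, hx.sq_eq_one]) v hv, hfix f34 _ (by simp [h34]) e he]
    simp
  · rw [map_mul, map_mul, map_mul, map_mul, hfix f012 _ (by simp [h012]) d hd,
      hzfix f012 _ (by simp [h012]) u hu, hfix f012 _ (by simp [h012]) w hw,
      hz f012 _ (by simp [h012, hx.sq_eq_one]) v hv, hkill f012 _ (by simp [h012]) e he]
    simp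

theorem factorization_unique (hx : IsGammaFamily p1 p2 p3 p4 x) (h2 : Even p2) (h3 : Even p3)
    (hlift : ∀ y : Fin 5 → G, IsGammaFamily p1 p2 p3 p4 y → ∃ f : G →* G, ∀ i, f (x i) = y i)
    {d d' u u' w w' v v' e e' : G}
    (hd : d ∈ Subgroup.closure (x '' {0, 1})) (hd' : d' ∈ Subgroup.closure (x '' {0, 1}))
    (hu : u ∈ Subgroup.zpowers ((x 1 * x 2) ^ 2)) (hu' : u' ∈ Subgroup.zpowers ((x 1 * x 2) ^ 2))
    (hw : w ∈ Subgroup.closure (x '' {2})) (hw' : w' ∈ Subgroup.closure (x '' {2}))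
    (hv : v ∈ Subgroup.zpowers ((x 2 * x 3) ^ 2)) (hv' : v' ∈ Subgroup.zpowers ((x 2 * x 3) ^ 2))
    (he : e ∈ Subgroup.closure (x '' {3, 4})) (he' : e' ∈ Subgroup.closure (x '' {3, 4}))
    (h : d * u * w * v * e = d' * u' * w' * v' * e') :
    d = d' ∧ u = u' ∧ w = w' ∧ v = v' ∧ e = e' := by
  obtain ⟨f01, f2, f34, f012, hf⟩ := hx.exists_projections h2 h3 hlift
  obtain ⟨a1, a2, a3, a4⟩ := hf d hd u hu w hw v hv e he
  obtain ⟨b1, b2, b3, b4⟩ := hf d' hd' u' hu' w' hw' v' hv' e' he'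
  rw [h] at a1 a2 a3 a4
  obtain rfl := a1.symm.trans b1
  obtain rfl := a2.symm.trans b2
  obtain rfl := a3.symm.trans b3
  have hu := a4.symm.trans b4
  rw [mul_left_inj, mul_right_inj] at hu
  subst hu
  rw [mul_left_inj, mul_right_inj] at h
  exact ⟨rfl, rfl, rfl, h, rfl⟩

theorem satisfies_interCond (hx : IsGammaFamily p1 p2 p3 p4 x)
    (hgen : Subgroup.closure (Set.range x) = ⊤) (h2 : Even p2) (h3 : Even p3)
    (hlift : ∀ y : Fin 5 → G, IsGammaFamily p1 p2 p3 p4 y → ∃ f : G →* G, ∀ i, f (x i) = y i)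
    (h01 : x 0 ≠ x 1) (h34 : x 3 ≠ x 4) : interCond x := by
  intro I J
  refine le_antisymm ?_ (le_inf (Subgroup.closure_mono (Set.image_mono Set.inter_subset_left))
    (Subgroup.closure_mono (Set.image_mono Set.inter_subset_right)))
  rintro g ⟨hgI, hgJ⟩
  obtain ⟨d, hd, u, hu, huI, w, hw, v, hv, hvI, e, he, hg⟩ := hx.exists_factorization hgen hgI
  obtain ⟨d', hd', u', hu', huJ, w', hw', v', hv', hvJ, e', he', hg'⟩ :=
    hx.exists_factorization hgen hgJ
  have hmono : ∀ {K A : Set (Fin 5)} {k : G}, k ∈ Subgroup.closure (x '' (K ∩ A)) →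
      k ∈ Subgroup.closure (x '' A) := fun hk =>
    Subgroup.closure_mono (Set.image_mono Set.inter_subset_right) hk
  obtain ⟨rfl, rfl, rfl, rfl, rfl⟩ := hx.factorization_unique h2 h3 hlift (hmono hd) (hmono hd')
    hu hu' (hmono hw) (hmono hw') hv hv' (hmono he) (hmono he') (hg.symm.trans hg')
  have hpart : ∀ {i j : Fin 5} {k : G}, (i ≠ j → x i ≠ x j) →
      k ∈ Subgroup.closure (x '' (I ∩ {i, j})) → k ∈ Subgroup.closure (x '' (J ∩ {i, j})) →
      k ∈ Subgroup.closure (x '' (I ∩ J)) := fun {i j k} hij hI hJ =>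
    Subgroup.closure_mono
      (Set.image_mono (Set.inter_subset_inter Set.inter_subset_left Set.inter_subset_left))
      (closure_inf_le_of_subset_pair (hx.sq_eq_one i) (hx.sq_eq_one j) hij
        Set.inter_subset_right Set.inter_subset_right ⟨hI, hJ⟩)
  have hgenmem : ∀ {i : Fin 5}, i ∈ I → i ∈ J → x i ∈ Subgroup.closure (x '' (I ∩ J)) :=
    fun hI hJ => Subgroup.subset_closure ⟨_, ⟨hI, hJ⟩, rfl⟩
  have hz : ∀ {i j : Fin 5} {k : G}, k ∈ Subgroup.zpowers ((x i * x j) ^ 2) →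
      (k = 1 ∨ i ∈ I ∧ j ∈ I) → (k = 1 ∨ i ∈ J ∧ j ∈ J) →
      k ∈ Subgroup.closure (x '' (I ∩ J)) := by
    rintro i j k hk (rfl | ⟨hiI, hjI⟩) hJ
    · exact one_mem _
    · rcases hJ with rfl | ⟨hiJ, hjJ⟩
      · exact one_mem _
      · exact (Subgroup.zpowers_le.2
          (pow_mem (mul_mem (hgenmem hiI hiJ) (hgenmem hjI hjJ)) 2)) hk
  rw [hg]
  refine mul_mem (mul_mem (mul_mem (mul_mem ?_ (hz hu huI huJ)) ?_) (hz hv hvI hvJ)) ?_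
  · exact hpart (fun _ => h01) hd hd'
  · exact hpart (i := 2) (j := 2) (fun h => absurd rfl h) (by simpa using hw) (by simpa using hw')
  · exact hpart (fun _ => h34) he he'

theorem card_eq (hx : IsGammaFamily p1 p2 p3 p4 x)
    (hgen : Subgroup.closure (Set.range x) = ⊤) (h2 : Even p2) (h3 : Even p3)
    (hlift : ∀ y : Fin 5 → G, IsGammaFamily p1 p2 p3 p4 y → ∃ f : G →* G, ∀ i, f (x i) = y i) :
    Nat.card G = orderOf (x 0 * x 1) * orderOf (x 1) * orderOf ((x 1 * x 2) ^ 2) * orderOf (x 2) *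
      orderOf ((x 2 * x 3) ^ 2) * orderOf (x 4 * x 3) * orderOf (x 3) := by
  have hclosure : ∀ i : Fin 5, Subgroup.closure (x '' {i}) = Subgroup.zpowers (x i) := fun i => by
    rw [Set.image_singleton, Subgroup.zpowers_eq_closure]
  have hle : ∀ {i j : Fin 5} {c e : G}, c ∈ Subgroup.zpowers (x i * x j) →
      e ∈ Subgroup.zpowers (x j) → c * e ∈ Subgroup.closure (x '' {i, j}) := by
    intro i j c e hc he
    have hi : x i ∈ Subgroup.closure (x '' {i, j}) := Subgroup.subset_closure ⟨i, by simp, rfl⟩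
    have hj : x j ∈ Subgroup.closure (x '' {i, j}) := Subgroup.subset_closure ⟨j, by simp, rfl⟩
    exact mul_mem (Subgroup.zpowers_le.2 (mul_mem hi hj) hc) (Subgroup.zpowers_le.2 hj he)
  have hge : ∀ {i j : Fin 5} {g : G}, g ∈ Subgroup.closure (x '' {i, j}) →
      ∃ c ∈ Subgroup.zpowers (x i * x j), ∃ e ∈ Subgroup.zpowers (x j), g = c * e := by
    intro i j g hg
    refine exists_mul_zpow_of_mem_closure_pair ?_ ?_
    · rw [mul_inv_rev, hx.inv_eq, hx.inv_eq, mul_assoc, mul_assoc, hx.mul_self, mul_one]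
    · refine (Subgroup.closure_le _).2 ?_ hg
      rintro _ ⟨k, hk, rfl⟩
      have hj : x j ∈ Subgroup.closure {x i * x j, x j} := Subgroup.subset_closure (by simp)
      rcases hk with rfl | rfl
      · have := mul_mem (Subgroup.subset_closure (by simp) :
          x k * x j ∈ Subgroup.closure {x k * x j, x j}) hj
        rwa [mul_assoc, hx.mul_self, mul_one] at this
      · exact hj
  have hcancel : ∀ {i j : Fin 5} {c c' e e' : G} (f : G →* G), f (x i) = x j → f (x j) = x j →
      c ∈ Subgroup.zpowers (x i * x j) → c' ∈ Subgroup.zpowers (x i * x j) →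
      e ∈ Subgroup.zpowers (x j) → e' ∈ Subgroup.zpowers (x j) → c * e = c' * e' →
      c = c' ∧ e = e' := by
    rintro i j _ _ _ _ f hi hj ⟨k, rfl⟩ ⟨k', rfl⟩ ⟨l, rfl⟩ ⟨l', rfl⟩ h
    have h' := congrArg f h
    simp only [map_mul, map_zpow, hi, hj, hx.mul_self, one_zpow, one_mul] at h'
    simp only [h', mul_left_inj] at h
    exact ⟨h, h'⟩
  obtain ⟨f1, hf1⟩ := hlift _ (hx.restrict_one h2)
  obtain ⟨f3, hf3⟩ := hlift _ (hx.restrict_three h3)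
  let F : Subgroup.zpowers (x 0 * x 1) × Subgroup.zpowers (x 1) ×
      Subgroup.zpowers ((x 1 * x 2) ^ 2) × Subgroup.zpowers (x 2) ×
      Subgroup.zpowers ((x 2 * x 3) ^ 2) × Subgroup.zpowers (x 4 * x 3) ×
      Subgroup.zpowers (x 3) → G := fun a =>
    (a.1 * a.2.1 : G) * a.2.2.1 * a.2.2.2.1 * a.2.2.2.2.1 * (a.2.2.2.2.2.1 * a.2.2.2.2.2.2)
  have hF : Function.Bijective F := by
    constructor
    · rintro ⟨⟨c, hc⟩, ⟨e, he⟩, ⟨u, hu⟩, ⟨w, hw⟩, ⟨v, hv⟩, ⟨b, hb⟩, ⟨a, ha⟩⟩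
        ⟨⟨c', hc'⟩, ⟨e', he'⟩, ⟨u', hu'⟩, ⟨w', hw'⟩, ⟨v', hv'⟩, ⟨b', hb'⟩, ⟨a', ha'⟩⟩ h
      obtain ⟨h1, rfl, rfl, rfl, h2⟩ := hx.factorization_unique h2 h3 hlift (hle hc he)
        (hle hc' he') hu hu' (by rwa [hclosure]) (by rwa [hclosure]) hv hv'
        (by rw [Set.pair_comm]; exact hle hb ha) (by rw [Set.pair_comm]; exact hle hb' ha') h
      obtain ⟨rfl, rfl⟩ := hcancel f1 (hf1 0) (hf1 1) hc hc' he he' h1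
      obtain ⟨rfl, rfl⟩ := hcancel f3 (hf3 4) (hf3 3) hb hb' ha ha' h2
      rfl
    · intro g
      have hg : g ∈ Subgroup.closure (x '' Set.univ) := by
        rw [Set.image_univ, hgen]; trivial
      obtain ⟨d, hd, u, hu, -, w, hw, v, hv, -, e, he, rfl⟩ := hx.exists_factorization hgen hg
      rw [Set.univ_inter] at hd hw he
      rw [hclosure] at hw
      rw [Set.pair_comm] at he
      obtain ⟨c, hc, y, hy, rfl⟩ := hge hd
      obtain ⟨b, hb, a, ha, rfl⟩ := hge he
      exact ⟨⟨⟨c, hc⟩, ⟨y, hy⟩, ⟨u, hu⟩, ⟨w, hw⟩, ⟨v, hv⟩, ⟨b, hb⟩, ⟨a, ha⟩⟩, rfl⟩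
  rw [← Nat.card_congr (Equiv.ofBijective F hF)]
  simp only [Nat.card_prod, Nat.card_zpowers, mul_assoc]

/-- The subgroup of even words has index two as soon as there is a homomorphism to `{1, -1}`
sending every generator to `-1`. -/
theorem index_rotation (hx : IsGammaFamily p1 p2 p3 p4 x)
    (hgen : Subgroup.closure (Set.range x) = ⊤) (s : G →* ℤˣ) (hs : ∀ i, s (x i) = -1) :
    (Subgroup.closure ({x 0 * x 1, x 1 * x 2, x 2 * x 3, x 3 * x 4} : Set G)).index = 2 := by
  set R := Subgroup.closure ({x 0 * x 1, x 1 * x 2, x 2 * x 3, x 3 * x 4} : Set G) with hR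
  have h01 : x 0 * x 1 ∈ R := Subgroup.subset_closure (by simp)
  have h12 : x 1 * x 2 ∈ R := Subgroup.subset_closure (by simp)
  have h23 : x 2 * x 3 ∈ R := Subgroup.subset_closure (by simp)
  have h34 : x 3 * x 4 ∈ R := Subgroup.subset_closure (by simp)
  have hstep : ∀ {i j : Fin 5}, x 0 * x i ∈ R → x i * x j ∈ R → x 0 * x j ∈ R := by
    intro i j h h'
    have := mul_mem h h'
    rwa [mul_assoc, ← mul_assoc (x i), hx.mul_self, one_mul] at this
  have h0 : ∀ i, x i * x 0 ∈ R := by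
    intro i
    have h : x 0 * x i ∈ R := by
      fin_cases i
      · simp [hx.mul_self, one_mem]
      · exact h01
      · exact hstep h01 h12
      · exact hstep (hstep h01 h12) h23
      · exact hstep (hstep (hstep h01 h12) h23) h34
    simpa [hx.inv_eq] using inv_mem h
  have hsR : ∀ g ∈ R, s g = 1 := by
    have : R ≤ s.ker := by
      rw [hR, Subgroup.closure_le]
      rintro _ (rfl | rfl | rfl | rfl) <;> simp [MonoidHom.mem_ker, hs]
    exact fun g hg => this hg
  have hcover : ∀ g, g * x 0 ∈ R ∨ g ∈ R := by
    intro g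
    have hg : g ∈ Subgroup.closure (Set.range x) := hgen ▸ Subgroup.mem_top g
    have hmul : ∀ i y, (y * x 0 ∈ R ∨ y ∈ R) → (y * x i * x 0 ∈ R ∨ y * x i ∈ R) := by
      rintro i y (h | h)
      · right
        have := mul_mem h (inv_mem (h0 i))
        simpa [hx.inv_eq, mul_assoc, ← mul_assoc (x 0) (x 0), hx.mul_self] using this
      · left
        rw [mul_assoc]
        exact mul_mem h (h0 i)
    induction hg using Subgroup.closure_induction_right with
    | one => right; exact one_mem _
    | mul_right y _ z hz ih =>
      obtain ⟨i, rfl⟩ := hz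
      exact hmul i y ih
    | mul_inv_cancel y _ z hz ih =>
      obtain ⟨i, rfl⟩ := hz
      rw [hx.inv_eq]
      exact hmul i y ih
  rw [Subgroup.index_eq_two_iff]
  refine ⟨x 0, fun b => ?_⟩
  rcases hcover b with h | h
  · refine Or.inl ⟨h, fun h' => ?_⟩
    have := hsR _ h
    rw [map_mul, hsR _ h', hs] at this
    exact absurd this (by decide)
  · refine Or.inr ⟨h, fun h' => ?_⟩
    have := hsR _ h'
    rw [map_mul, hsR _ h, hs] at this
    exact absurd this (by decide)

theorem neg_one {p1 p2 p3 p4 : ℕ} :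
    IsGammaFamily p1 p2 p3 p4 (fun _ => (-1 : ℤˣ)) where
  sq_eq_one _ := by simp
  pow_one := by simp
  pow_two := by simp
  pow_three := by simp
  pow_four := by simp
  comm _ _ _ := by simp
  left := by decide
  middle := by decide
  right := by decide

theorem dihedral {p1 p2 p3 p4 : ℕ} (h2 : Even p2) :
    IsGammaFamily p1 p2 p3 p4
      ![DihedralGroup.sr (0 : ZMod p1), DihedralGroup.sr 1, 1, 1, 1] where
  sq_eq_one i := by fin_cases i <;> simp [sq]
  pow_one := by simp
  pow_two := by
    obtain ⟨k, rfl⟩ := h2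
    simp [← two_mul, pow_mul, sq]
  pow_three := by simp
  pow_four := by simp
  comm i j h := by fin_cases i <;> fin_cases j <;> simp [sq] at h ⊢
  left := by simp [sq]
  middle := by simp [sq]
  right := by simp

theorem dihedral_of_dvd {p1 a p3 p4 : ℕ} (ha : a ∣ p1) (h3 : Even p3) :
    IsGammaFamily p1 (2 * a) p3 p4
      ![DihedralGroup.sr (0 : ZMod a), DihedralGroup.sr 1, DihedralGroup.sr 0, 1, 1] where
  sq_eq_one i := by fin_cases i <;> simp [sq]
  pow_one := by
    obtain ⟨k, rfl⟩ := ha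
    simp [pow_mul]
  pow_two := by simp
  pow_three := by
    obtain ⟨k, rfl⟩ := h3
    simp [← two_mul, pow_mul, sq]
  pow_four := by simp
  comm i j h := by fin_cases i <;> fin_cases j <;> simp [sq] at h ⊢
  left := by simp [sq]
  middle := by simp [sq]
  right := by simp

theorem orderOf_generator (hx : IsGammaFamily p1 p2 p3 p4 x) (s : G →* ℤˣ)
    (hs : ∀ i, s (x i) = -1) (i : Fin 5) : orderOf (x i) = 2 := by
  refine orderOf_eq_prime (hx.sq_eq_one i) fun h => ?_
  have := hs i
  rw [h, map_one] at this
  exact absurd this (by decide)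

/-- The orders of `x_0 x_1`, `(x_1 x_2)^2` and `x_1 x_2` in a group universal for the relations. -/
theorem orderOf_left {G : Type} [Group G] {p1 a p3 p4 : ℕ} {x : Fin 5 → G}
    (hx : IsGammaFamily p1 (2 * a) p3 p4 x) (ha : a ∣ p1) (h1 : Odd p1) (h3 : Even p3)
    (hlift : ∀ (H : Type) [Group H] (y : Fin 5 → H), IsGammaFamily p1 (2 * a) p3 p4 y →
      ∃ f : G →* H, ∀ i, f (x i) = y i) :
    orderOf (x 0 * x 1) = p1 ∧ orderOf ((x 1 * x 2) ^ 2) = a ∧ orderOf (x 1 * x 2) = 2 * a := by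
  have haodd : Odd a := h1.of_dvd_nat ha
  have h01 : orderOf (x 0 * x 1) = p1 := by
    obtain ⟨f, hf⟩ := hlift _ _ (dihedral (p3 := p3) (p4 := p4) (even_two_mul a))
    refine Nat.dvd_antisymm (orderOf_dvd_of_pow_eq_one hx.pow_one) ?_
    have := orderOf_map_dvd f (x 0 * x 1)
    simpa [hf, DihedralGroup.orderOf_r_one] using this
  have ht : orderOf ((x 1 * x 2) ^ 2) = a := by
    obtain ⟨f, hf⟩ := hlift _ _ (dihedral_of_dvd (p4 := p4) ha h3)
    refine Nat.dvd_antisymm (orderOf_dvd_of_pow_eq_one ?_) ?_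
    · rw [← pow_mul, hx.pow_two]
    have := orderOf_map_dvd f ((x 1 * x 2) ^ 2)
    have hr : f (x 1 * x 2) = (DihedralGroup.r 1)⁻¹ := by simp [hf]
    rw [map_pow, hr, inv_pow, orderOf_inv, Nat.Coprime.orderOf_pow] at this
    · rwa [DihedralGroup.orderOf_r_one] at this
    · rw [DihedralGroup.orderOf_r_one]
      exact haodd.coprime_two_right
  refine ⟨h01, ht, Nat.dvd_antisymm (orderOf_dvd_of_pow_eq_one hx.pow_two) ?_⟩
  refine haodd.coprime_two_left.mul_dvd_of_dvd_of_dvd ?_ ?_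
  · obtain ⟨s, hs⟩ := hlift _ _ neg_one
    obtain ⟨f, hf⟩ := hlift _ _ (hx.restrict_two (even_two_mul a) h3)
    have := orderOf_map_dvd f (x 1 * x 2)
    simpa [hf, hx.orderOf_generator s hs] using this
  · conv_lhs => rw [← ht]
    exact orderOf_pow_dvd 2

end IsGammaFamily

/-- If `p_1, p_4 ≥ 3` are odd, `p_2` is an even positive divisor of `2 p_1`, and `p_3` is an
even positive divisor of `2 p_4`, then `Γ(p_1, p_2, p_3, p_4)` satisfies the intersection
condition, `x_{i-1} x_i` has order exactly `p_i` for `1 ≤ i ≤ 4`,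
`|Γ(p_1, p_2, p_3, p_4)| = 2 p_1 p_2 p_3 p_4`, and the rotation subgroup has index 2
(i.e. `P(p_1,p_2,p_3,p_4)` is a tight orientably-regular polytope of type
`{p_1, p_2, p_3, p_4}`). -/
theorem gamma_rank_five (p1 p2 p3 p4 : ℕ) (h1 : 3 ≤ p1) (h1odd : Odd p1)
    (h4 : 3 ≤ p4) (h4odd : Odd p4)
    (h2pos : 0 < p2) (h2even : Even p2) (h2dvd : p2 ∣ 2 * p1)
    (h3pos : 0 < p3) (h3even : Even p3) (h3dvd : p3 ∣ 2 * p4) :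
    let P := pfun4 p1 p2 p3 p4
    interCond (xg 5 P) ∧
    orderOf (xg 5 P 0 * xg 5 P 1) = p1 ∧
    orderOf (xg 5 P 1 * xg 5 P 2) = p2 ∧
    orderOf (xg 5 P 2 * xg 5 P 3) = p3 ∧
    orderOf (xg 5 P 3 * xg 5 P 4) = p4 ∧
    Nat.card (Gamma 5 P) = 2 * (p1 * p2 * p3 * p4) ∧
    (Subgroup.closure ({xg 5 P 0 * xg 5 P 1, xg 5 P 1 * xg 5 P 2, xg 5 P 2 * xg 5 P 3,
      xg 5 P 3 * xg 5 P 4} : Set (Gamma 5 P))).index = 2 := by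
  intro P
  obtain ⟨a, rfl⟩ := h2even.two_dvd
  obtain ⟨b, rfl⟩ := h3even.two_dvd
  have ha : a ∣ p1 := Nat.dvd_of_mul_dvd_mul_left two_pos h2dvd
  have hb : b ∣ p4 := Nat.dvd_of_mul_dvd_mul_left two_pos h3dvd
  have hx : IsGammaFamily p1 (2 * a) (2 * b) p4 (xg 5 P) :=
    isGammaFamily_xg h1odd h2even h3even h4odd
  have hlift : ∀ (H : Type) [Group H] (y : Fin 5 → H), IsGammaFamily p1 (2 * a) (2 * b) p4 y →
      ∃ f : Gamma 5 P →* H, ∀ i, f (xg 5 P i) = y i := fun H _ y hy =>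
    hy.exists_hom h1odd h2even h3even h4odd
  have hlift' : ∀ (H : Type) [Group H] (y : Fin 5 → H), IsGammaFamily p4 (2 * b) (2 * a) p1 y →
      ∃ f : Gamma 5 P →* H,
        ∀ i, f (![xg 5 P 4, xg 5 P 3, xg 5 P 2, xg 5 P 1, xg 5 P 0] i) = y i := fun H _ y hy => by
    obtain ⟨f, hf⟩ := hlift H _ hy.reverse
    exact ⟨f, fun i => by fin_cases i <;> simp [hf]⟩
  have hgen : Subgroup.closure (Set.range (xg 5 P)) = ⊤ := PresentedGroup.closure_range_of _
  obtain ⟨s, hs⟩ := hlift _ _ IsGammaFamily.neg_one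
  have hord := hx.orderOf_generator s hs
  obtain ⟨o01, ot, o12⟩ := hx.orderOf_left ha h1odd h3even hlift
  obtain ⟨o43, ot', o32⟩ := hx.reverse.orderOf_left hb h4odd h2even hlift'
  change orderOf (xg 5 P 4 * xg 5 P 3) = p4 at o43
  change orderOf ((xg 5 P 3 * xg 5 P 2) ^ 2) = b at ot'
  change orderOf (xg 5 P 3 * xg 5 P 2) = 2 * b at o32
  have hne : ∀ i j, orderOf (xg 5 P i * xg 5 P j) ≠ 1 → xg 5 P i ≠ xg 5 P j := by
    rintro i j h e
    rw [e, hx.mul_self, orderOf_one] at h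
    exact h rfl
  have hcomm : ∀ i j, xg 5 P i * xg 5 P j = (xg 5 P j * xg 5 P i)⁻¹ := fun i j => by
    rw [mul_inv_rev, hx.inv_eq, hx.inv_eq]
  refine ⟨hx.satisfies_interCond hgen h2even h3even (hlift _) (hne 0 1 (by omega))
    (hne 4 3 (by omega)).symm, o01, o12, ?_, ?_, ?_, hx.index_rotation hgen s hs⟩
  · rw [hcomm, orderOf_inv, o32]
  · rw [hcomm, orderOf_inv, o43]
  · rw [hx.card_eq hgen h2even h3even (hlift _), o01, hord, ot, hord, hcomm 2 3, inv_pow,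
      orderOf_inv, ot', o43, hord]
    ring
end
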